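/- arXiv:1007.3015 — 3 statements merged into one kernel-verified Lean document; each statement's English description precedes it below -/
import Mathlib

section
/- The invariant ring ℂ[V ⊕ V]^{SL₂}, where V is the adjoint representation of SL₂(ℂ) with bases {a^h_i, a^x_i, a^y_i} (i = 1, 2), is generated by the three quadratics q_{11}, q_{12}, q_{22}, where q_{ij} = a^h_i a^h_j + 2 a^x_i a^y_j + 2 a^x_j a^y_i; moreover these three generators are algebraically independent. -/
open MvPolynomial

/-- Structure constants of `sl₂` in the basis `0 = h`, `1 = x`, `2 = y`
(root basis with `[x,y] = h`, `[h,x] = 2x`, `[h,y] = -2y`):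
`slBr ξ η θ` is the coefficient of the basis vector `θ` in `[ξ, η]`. -/
noncomputable def slBr : Fin 3 → Fin 3 → Fin 3 → ℂ :=
  ![![![0,0,0], ![0,2,0], ![0,0,-2]],
    ![![0,-2,0], ![0,0,0], ![1,0,0]],
    ![![0,0,2], ![-1,0,0], ![0,0,0]]]

/-- The derivation of `ℂ[V ⊕ ⋯ ⊕ V] = ℂ[a^ξ_i]` (`m` copies of the adjoint
representation `V` of `sl₂`) given by the action of the basis element `ξ` of `sl₂`:
on generators, `ξ · a^η_i = a^{[ξ,η]}_i`. -/
noncomputable def adjDer (m : ℕ) (ξ : Fin 3) :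
    Derivation ℂ (MvPolynomial (Fin m × Fin 3) ℂ) (MvPolynomial (Fin m × Fin 3) ℂ) :=
  MvPolynomial.mkDerivation ℂ fun v => ∑ θ : Fin 3, C (slBr ξ v.2 θ) * X (v.1, θ)

/-- The quadratic invariant `q_{ij} = a^h_i a^h_j + 2 a^x_i a^y_j + 2 a^x_j a^y_i`
for `m` copies of the adjoint representation. -/
noncomputable def qAdj (m : ℕ) (i j : Fin m) : MvPolynomial (Fin m × Fin 3) ℂ :=
  X (i, 0) * X (j, 0) + 2 * X (i, 1) * X (j, 2) + 2 * X (j, 1) * X (i, 2)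

/-- A polynomial killed by a derivation is constant along integral curves of that derivation. -/
lemma eval_eq_of_integralCurve {σ : Type*}
    (D : Derivation ℂ (MvPolynomial σ ℂ) (MvPolynomial σ ℂ)) (f : ℂ → σ → ℂ)
    (hf : ∀ i z, HasDerivAt (fun w => f w i) (eval (f z) (D (X i))) z)
    {p : MvPolynomial σ ℂ} (hp : D p = 0) (z w : ℂ) :
    eval (f z) p = eval (f w) p := by
  have key : ∀ (q : MvPolynomial σ ℂ) (z : ℂ),
      HasDerivAt (fun w => eval (f w) q) (eval (f z) (D q)) z := by
    intro q
    induction q using MvPolynomial.induction_on with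
    | C a =>
      intro z
      have : D (C a) = 0 := D.map_algebraMap a
      simpa [this] using hasDerivAt_const z a
    | add p q hp hq =>
      intro z
      simp only [map_add]
      exact (hp z).add (hq z)
    | mul_X p i hp =>
      intro z
      have h := (hp z).mul (hf i z)
      simp only [Derivation.leibniz, smul_eq_mul, map_add, map_mul, eval_X]
      exact h.congr_deriv (by ring)
  refine is_const_of_deriv_eq_zero (fun z => (key p z).differentiableAt) (fun z => ?_) z w
  simpa [hp] using (key p z).deriv

/-- The point of `V ⊕ V` with the given coordinates. -/
def sl2Pair (h₁ x₁ y₁ h₂ x₂ y₂ : ℂ) : Fin 2 × Fin 3 → ℂ :=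
  fun v => ![![h₁, x₁, y₁], ![h₂, x₂, y₂]] v.1 v.2

lemma eq_sl2Pair (v : Fin 2 × Fin 3 → ℂ) :
    v = sl2Pair (v (0, 0)) (v (0, 1)) (v (0, 2)) (v (1, 0)) (v (1, 1)) (v (1, 2)) := by
  ext ⟨i, j⟩
  fin_cases i <;> fin_cases j <;> simp [sl2Pair]

lemma eval_qAdj (v : Fin 2 × Fin 3 → ℂ) (i j : Fin 2) :
    eval v (qAdj 2 i j) =
      v (i, 0) * v (j, 0) + 2 * v (i, 1) * v (j, 2) + 2 * v (j, 1) * v (i, 2) := by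
  simp [qAdj]

section Flows

variable {p : MvPolynomial (Fin 2 × Fin 3) ℂ} (h₁ x₁ y₁ h₂ x₂ y₂ : ℂ)

lemma eval_sl2Pair_raise (hp : adjDer 2 1 p = 0) (t : ℂ) :
    eval (sl2Pair (h₁ - 2 * t * x₁) x₁ (y₁ + t * h₁ - t ^ 2 * x₁)
      (h₂ - 2 * t * x₂) x₂ (y₂ + t * h₂ - t ^ 2 * x₂)) p =
      eval (sl2Pair h₁ x₁ y₁ h₂ x₂ y₂) p := by
  have hh (a b z : ℂ) : HasDerivAt (fun w : ℂ => a - 2 * w * b) (-2 * b) z := by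
    exact ((((hasDerivAt_id' z).const_mul 2).mul_const b).const_sub a).congr_deriv (by ring)
  have hy (a b c z : ℂ) :
      HasDerivAt (fun w : ℂ => a + w * b - w ^ 2 * c) (b - 2 * z * c) z := by
    exact ((((hasDerivAt_id' z).mul_const b).const_add a).sub
      (((hasDerivAt_id' z).pow 2).mul_const c)).congr_deriv (by norm_num)
  have := eval_eq_of_integralCurve (adjDer 2 1)
    (fun t => sl2Pair (h₁ - 2 * t * x₁) x₁ (y₁ + t * h₁ - t ^ 2 * x₁)
      (h₂ - 2 * t * x₂) x₂ (y₂ + t * h₂ - t ^ 2 * x₂)) (by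
      rintro ⟨i, j⟩ z
      fin_cases i <;> fin_cases j <;>
        simp [adjDer, mkDerivation_X, slBr, sl2Pair, Fin.sum_univ_three] <;>
        first
          | exact hasDerivAt_const _ _
          | simpa using hh _ _ z
          | exact hy _ _ _ z) hp t 0
  simpa using this

lemma eval_sl2Pair_lower (hp : adjDer 2 2 p = 0) (t : ℂ) :
    eval (sl2Pair (h₁ + 2 * t * y₁) (x₁ - t * h₁ - t ^ 2 * y₁) y₁
      (h₂ + 2 * t * y₂) (x₂ - t * h₂ - t ^ 2 * y₂) y₂) p =
      eval (sl2Pair h₁ x₁ y₁ h₂ x₂ y₂) p := by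
  have hh (a b z : ℂ) : HasDerivAt (fun w : ℂ => a + 2 * w * b) (2 * b) z := by
    exact ((((hasDerivAt_id' z).const_mul 2).mul_const b).const_add a).congr_deriv (by ring)
  have hx (a b c z : ℂ) :
      HasDerivAt (fun w : ℂ => a - w * b - w ^ 2 * c) (-(b + 2 * z * c)) z := by
    exact ((((hasDerivAt_id' z).mul_const b).const_sub a).sub
      (((hasDerivAt_id' z).pow 2).mul_const c)).congr_deriv (by norm_num; ring)
  have := eval_eq_of_integralCurve (adjDer 2 2)
    (fun t => sl2Pair (h₁ + 2 * t * y₁) (x₁ - t * h₁ - t ^ 2 * y₁) y₁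
      (h₂ + 2 * t * y₂) (x₂ - t * h₂ - t ^ 2 * y₂) y₂) (by
      rintro ⟨i, j⟩ z
      fin_cases i <;> fin_cases j <;>
        simp [adjDer, mkDerivation_X, slBr, sl2Pair, Fin.sum_univ_three] <;>
        first
          | exact hasDerivAt_const _ _
          | simpa using hh 0 _ z
          | simpa using hx _ _ _ z) hp t 0
  simpa using this

lemma eval_sl2Pair_torus (hp : adjDer 2 0 p = 0) {c : ℂ} (hc : c ≠ 0) :
    eval (sl2Pair h₁ (c⁻¹ * x₁) (c * y₁) h₂ (c⁻¹ * x₂) (c * y₂)) p =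
      eval (sl2Pair h₁ x₁ y₁ h₂ x₂ y₂) p := by
  have he (k a z : ℂ) :
      HasDerivAt (fun w : ℂ => Complex.exp (k * w) * a) (k * (Complex.exp (k * z) * a)) z := by
    exact ((((hasDerivAt_id' z).const_mul k).cexp).mul_const a).congr_deriv (by ring)
  have := eval_eq_of_integralCurve (adjDer 2 0)
    (fun t => sl2Pair h₁ (Complex.exp (2 * t) * x₁) (Complex.exp (-2 * t) * y₁)
      h₂ (Complex.exp (2 * t) * x₂) (Complex.exp (-2 * t) * y₂)) (by
      rintro ⟨i, j⟩ z
      fin_cases i <;> fin_cases j <;>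
        simp [adjDer, mkDerivation_X, slBr, sl2Pair, Fin.sum_univ_three] <;>
        first
          | exact hasDerivAt_const _ _
          | exact he _ _ z
          | simpa using he (-2) _ z) hp (-(Complex.log c / 2)) 0
  have h1 : Complex.exp (2 * -(Complex.log c / 2)) = c⁻¹ := by
    rw [show 2 * -(Complex.log c / 2) = -Complex.log c by ring, Complex.exp_neg,
      Complex.exp_log hc]
  have h2 : Complex.exp (-2 * -(Complex.log c / 2)) = c := by
    rw [show -2 * -(Complex.log c / 2) = Complex.log c by ring, Complex.exp_log hc]
  simp only [h1, h2] at this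
  simpa using this

end Flows

/-- Up to the flows of `sl₂`, a generic pair is determined by its Gram matrix, with either choice
of square root of `q₂₂`. -/
lemma eval_eq_eval_slice {p : MvPolynomial (Fin 2 × Fin 3) ℂ}
    (hp : ∀ ξ : Fin 3, adjDer 2 ξ p = 0) {h₁ x₁ y₁ h₂ x₂ y₂ A B h : ℂ}
    (hA : A = h₁ * h₁ + 4 * x₁ * y₁) (hB : B = h₁ * h₂ + 2 * x₁ * y₂ + 2 * x₂ * y₁)
    (hh : h ^ 2 = h₂ * h₂ + 4 * x₂ * y₂) (hy : y₂ ≠ 0) (hdisc : A * h ^ 2 - B ^ 2 ≠ 0) :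
    eval (sl2Pair h₁ x₁ y₁ h₂ x₂ y₂) p = eval (sl2Pair 0 1 (A / 4) h 0 (B / 2)) p := by
  obtain ⟨t, ht⟩ : ∃ t, h = h₂ + 2 * t * y₂ := ⟨(h - h₂) / (2 * y₂), by field_simp; ring⟩
  have hx₂ : x₂ - t * h₂ - t ^ 2 * y₂ = 0 := by
    apply mul_left_cancel₀ hy
    rw [ht] at hh
    linear_combination -hh / 4
  obtain ⟨k, hk⟩ : ∃ k, k = h₁ + 2 * t * y₁ := ⟨_, rfl⟩
  obtain ⟨c, hc⟩ : ∃ c, c = x₁ - t * h₁ - t ^ 2 * y₁ := ⟨_, rfl⟩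
  have hA' : A = k * k + 4 * c * y₁ := by rw [hA, hk, hc]; ring
  have hB' : B = k * h + 2 * c * y₂ := by
    rw [hB, hk, hc, ht]; linear_combination 2 * y₁ * hx₂
  have hc0 : c ≠ 0 := by
    rintro rfl
    exact hdisc (by rw [hA', hB']; ring)
  rw [← eval_sl2Pair_lower h₁ x₁ y₁ h₂ x₂ y₂ (hp 2) t, hx₂, ← ht, ← hk, ← hc,
    ← eval_sl2Pair_torus _ _ _ _ _ _ (hp 0) hc0, ← eval_sl2Pair_raise _ _ _ _ _ _ (hp 1) (k / 2)]
  congr 2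
  rw [inv_mul_cancel₀ hc0, hA', hB']
  congr 1 <;> ring

lemma exists_eval_slice (p : MvPolynomial (Fin 2 × Fin 3) ℂ) :
    ∃ Q R : MvPolynomial (Fin 3) ℂ, ∀ A B h : ℂ,
      eval (sl2Pair 0 1 (A / 4) h 0 (B / 2)) p =
        eval ![A, B, h ^ 2] Q + h * eval ![A, B, h ^ 2] R := by
  induction p using MvPolynomial.induction_on with
  | C a => exact ⟨C a, 0, by simp⟩
  | add p q hp hq =>
    obtain ⟨Q, R, hp⟩ := hp
    obtain ⟨Q', R', hq⟩ := hq
    exact ⟨Q + Q', R + R', fun A B h => by simp only [map_add, hp, hq]; ring⟩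
  | mul_X p i hp =>
    obtain ⟨Q, R, hp⟩ := hp
    simp only [map_mul, hp, eval_X]
    obtain ⟨i, j⟩ := i
    fin_cases i <;> fin_cases j
    · exact ⟨0, 0, fun A B h => by simp [sl2Pair]⟩
    · exact ⟨Q, R, fun A B h => by simp [sl2Pair]⟩
    · exact ⟨Q * X 0 * C (1 / 4), R * X 0 * C (1 / 4), fun A B h => by simp [sl2Pair]; ring⟩
    · exact ⟨R * X 2, Q, fun A B h => by simp [sl2Pair]; ring⟩
    · exact ⟨0, 0, fun A B h => by simp [sl2Pair]⟩
    · exact ⟨Q * X 1 * C (1 / 2), R * X 1 * C (1 / 2), fun A B h => by simp [sl2Pair]; ring⟩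

lemma eval_aeval_qAdj (v : Fin 2 × Fin 3 → ℂ) (Q : MvPolynomial (Fin 3) ℂ) :
    eval v (aeval ![qAdj 2 0 0, qAdj 2 0 1, qAdj 2 1 1] Q) =
      eval ![eval v (qAdj 2 0 0), eval v (qAdj 2 0 1), eval v (qAdj 2 1 1)] Q := by
  induction Q using MvPolynomial.induction_on with
  | C a => simp
  | add p q hp hq => simp only [map_add, hp, hq]
  | mul_X p i hp =>
    simp only [map_mul, hp, aeval_X, eval_X]
    fin_cases i <;> simp

lemma exists_aeval_qAdj_eq {p : MvPolynomial (Fin 2 × Fin 3) ℂ}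
    (hp : ∀ ξ : Fin 3, adjDer 2 ξ p = 0) :
    ∃ Q : MvPolynomial (Fin 3) ℂ, p = aeval ![qAdj 2 0 0, qAdj 2 0 1, qAdj 2 1 1] Q := by
  obtain ⟨Q, R, hQ⟩ := exists_eval_slice p
  refine ⟨Q, ?_⟩
  let d : MvPolynomial (Fin 2 × Fin 3) ℂ :=
    X (1, 2) * (qAdj 2 0 0 * qAdj 2 1 1 - qAdj 2 0 1 ^ 2)
  have hd : d ≠ 0 := by
    intro h
    have := congrArg (eval (sl2Pair 1 0 0 0 1 1)) h
    simp [d, eval_qAdj, sl2Pair] at this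
  have hmul : d * (p - aeval ![qAdj 2 0 0, qAdj 2 0 1, qAdj 2 1 1] Q) = 0 := by
    apply MvPolynomial.funext
    intro v
    simp only [map_mul, map_sub, map_zero, eval_aeval_qAdj]
    rcases eq_or_ne (eval v d) 0 with h0 | h0
    · rw [h0, zero_mul]
    simp only [d, map_mul, map_sub, map_pow, eval_X] at h0
    have hy := left_ne_zero_of_mul h0
    have hdisc := right_ne_zero_of_mul h0
    obtain ⟨h, hh⟩ := IsAlgClosed.exists_pow_nat_eq (eval v (qAdj 2 1 1)) two_pos
    rw [← hh] at hdisc ⊢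
    have key : ∀ k : ℂ, k ^ 2 = h ^ 2 → eval v p =
        eval (sl2Pair 0 1 (eval v (qAdj 2 0 0) / 4) k 0 (eval v (qAdj 2 0 1) / 2)) p := by
      intro k hk
      conv_lhs => rw [eq_sl2Pair v]
      refine eval_eq_eval_slice hp ?_ ?_ ?_ hy (by rwa [hk])
      · rw [eval_qAdj]; ring
      · rw [eval_qAdj]
      · rw [hk, hh, eval_qAdj]; ring
    have h1 := key h rfl
    have h2 := key (-h) (by ring)
    rw [hQ] at h1 h2
    rw [neg_sq] at h2
    rw [show eval v p = eval ![eval v (qAdj 2 0 0), eval v (qAdj 2 0 1), h ^ 2] Q by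
      linear_combination (h1 + h2) / 2, sub_self, mul_zero]
  exact sub_eq_zero.mp ((mul_eq_zero.mp hmul).resolve_left hd)

lemma adjDer_qAdj (ξ : Fin 3) (i j : Fin 2) : adjDer 2 ξ (qAdj 2 i j) = 0 := by
  have h2 (D : Derivation ℂ (MvPolynomial (Fin 2 × Fin 3) ℂ) (MvPolynomial (Fin 2 × Fin 3) ℂ)) :
      D 2 = 0 := D.map_natCast 2
  have hC : (C 2 : MvPolynomial (Fin 2 × Fin 3) ℂ) = 2 := map_ofNat C 2
  fin_cases ξ <;>
    simp [adjDer, qAdj, h2, hC, mkDerivation_X, slBr, Fin.sum_univ_three] <;> ring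

theorem stmt_5 :
    (∀ p : MvPolynomial (Fin 2 × Fin 3) ℂ,
      (∀ ξ : Fin 3, adjDer 2 ξ p = 0) ↔
        p ∈ Algebra.adjoin ℂ {qAdj 2 0 0, qAdj 2 0 1, qAdj 2 1 1}) ∧
    AlgebraicIndependent ℂ ![qAdj 2 0 0, qAdj 2 0 1, qAdj 2 1 1] := by
  refine ⟨fun p => ⟨fun hp => ?_, fun hp ξ => ?_⟩, ?_⟩
  · obtain ⟨Q, rfl⟩ := exists_aeval_qAdj_eq hp
    have hmem : aeval ![qAdj 2 0 0, qAdj 2 0 1, qAdj 2 1 1] Q ∈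
        Algebra.adjoin ℂ (Set.range ![qAdj 2 0 0, qAdj 2 0 1, qAdj 2 1 1]) := by
      rw [Algebra.adjoin_range_eq_range_aeval]
      exact ⟨Q, rfl⟩
    refine Algebra.adjoin_mono ?_ hmem
    rintro _ ⟨i, rfl⟩
    fin_cases i <;> simp
  · induction hp using Algebra.adjoin_induction with
    | mem q hq => rcases hq with rfl | rfl | rfl <;> exact adjDer_qAdj _ _ _
    | algebraMap r => exact (adjDer 2 ξ).map_algebraMap r
    | add p q _ _ hp hq => rw [map_add, hp, hq, add_zero]
    | mul p q _ _ hp hq => rw [Derivation.leibniz, hp, hq, smul_zero, smul_zero, add_zero]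
  · rw [algebraicIndependent_iff]
    intro Q hQ
    apply MvPolynomial.funext
    intro v
    obtain ⟨h, hh⟩ := IsAlgClosed.exists_pow_nat_eq (v 2) two_pos
    have := congrArg (eval (sl2Pair 0 1 (v 0 / 4) h 0 (v 1 / 2))) hQ
    rw [eval_aeval_qAdj, map_zero] at this
    rw [map_zero, ← this]
    congr 2
    ext i
    fin_cases i <;> simp [eval_qAdj, sl2Pair, ← hh] <;> ring
end

section
/- The invariant ring ℂ[V ⊕ V ⊕ V]^{SL₂}, where V is the adjoint representation of SL₂(ℂ), is generated by the six quadratics q_{ij} (1 ≤ i ≤ j ≤ 3) and the cubic c_{123}, and the ideal of relations among these seven generators is principal, generated by (c_{123})² + (1/4) det [[q_{11}, q_{12}, q_{13}], [q_{12}, q_{22}, q_{23}], [q_{13}, q_{23}, q_{33}]]. -/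
open MvPolynomial

/-- The cubic invariant `c_{123}` for three copies of the adjoint representation:
the determinant of the 3×3 matrix with rows `(a^h_i, a^x_i, a^y_i)`, `i = 1,2,3`. -/
noncomputable def cAdj : MvPolynomial (Fin 3 × Fin 3) ℂ :=
  Matrix.det (Matrix.of fun i ξ : Fin 3 => X (i, ξ))

/-- The flow of `adjDer 3 1`. -/
def flowX {A : Type*} [CommRing A] (t : A) (v : Fin 3 × Fin 3 → A) : Fin 3 × Fin 3 → A :=
  fun i => ![v (i.1, 0) - 2 * t * v (i.1, 1), v (i.1, 1),
    v (i.1, 2) + t * v (i.1, 0) - t ^ 2 * v (i.1, 1)] i.2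

/-- The flow of `adjDer 3 2`. -/
def flowY {A : Type*} [CommRing A] (t : A) (v : Fin 3 × Fin 3 → A) : Fin 3 × Fin 3 → A :=
  fun i => ![v (i.1, 0) + 2 * t * v (i.1, 2),
    v (i.1, 1) - t * v (i.1, 0) - t ^ 2 * v (i.1, 2), v (i.1, 2)] i.2

theorem eval_eq_of_flow (φ : Fin 3 × Fin 3 → Polynomial ℂ)
    (D : Derivation ℂ (MvPolynomial (Fin 3 × Fin 3) ℂ) (MvPolynomial (Fin 3 × Fin 3) ℂ))
    (h : ∀ i, (φ i).derivative = aeval φ (D (X i)))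
    {p : MvPolynomial (Fin 3 × Fin 3) ℂ} (hp : D p = 0) (s t : ℂ) :
    eval (fun i => (φ i).eval s) p = eval (fun i => (φ i).eval t) p := by
  have hd : ∀ q, (aeval φ q).derivative = aeval φ (D q) := by
    intro q
    induction q using MvPolynomial.induction_on with
    | C a => simp [Polynomial.algebraMap_eq]
    | add p q hp hq => simp [hp, hq]
    | mul_X p i hp => simp [hp, h]; ring
  have he : ∀ (s : ℂ) q, (aeval φ q).eval s = eval (fun i => (φ i).eval s) q := by
    intro s q
    induction q using MvPolynomial.induction_on with
    | C a => simp [Polynomial.algebraMap_eq]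
    | add p q hp hq => simp [hp, hq]
    | mul_X p i hp => simp [hp]
  have h0 := Polynomial.eq_C_of_derivative_eq_zero ((hd p).trans (by rw [hp, map_zero]))
  rw [← he, ← he, h0]
  simp

theorem adjDer_X (m : ℕ) (ξ : Fin 3) (i : Fin m × Fin 3) :
    adjDer m ξ (X i) = ∑ θ : Fin 3, C (slBr ξ i.2 θ) * X (i.1, θ) :=
  mkDerivation_X _ _ _

theorem eval_flowX {p : MvPolynomial (Fin 3 × Fin 3) ℂ} (hp : adjDer 3 1 p = 0) (t : ℂ)
    (v : Fin 3 × Fin 3 → ℂ) : eval (flowX t v) p = eval v p := by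
  have := eval_eq_of_flow (flowX Polynomial.X fun i => Polynomial.C (v i)) (adjDer 3 1)
    (by
      rintro ⟨i, j⟩
      fin_cases j <;>
        simp [adjDer_X, Fin.sum_univ_three, slBr, flowX, map_ofNat]; ring) hp t 0
  convert this using 2 <;>
  · congr 1
    funext ⟨i, j⟩
    fin_cases j <;> simp [flowX] <;> ring

theorem eval_flowY {p : MvPolynomial (Fin 3 × Fin 3) ℂ} (hp : adjDer 3 2 p = 0) (t : ℂ)
    (v : Fin 3 × Fin 3 → ℂ) : eval (flowY t v) p = eval v p := by
  have := eval_eq_of_flow (flowY Polynomial.X fun i => Polynomial.C (v i)) (adjDer 3 2)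
    (by
      rintro ⟨i, j⟩
      fin_cases j <;>
        simp [adjDer_X, Fin.sum_univ_three, slBr, flowY, map_ofNat]; ring) hp t 0
  convert this using 2 <;>
  · congr 1
    funext ⟨i, j⟩
    fin_cases j <;> simp [flowY] <;> ring

/-- The seven basic invariants evaluated at a triple of vectors. -/
def invVal (v : Fin 3 × Fin 3 → ℂ) : Fin 7 → ℂ :=
  ![v (0, 0) * v (0, 0) + 2 * v (0, 1) * v (0, 2) + 2 * v (0, 1) * v (0, 2),
    v (0, 0) * v (1, 0) + 2 * v (0, 1) * v (1, 2) + 2 * v (1, 1) * v (0, 2),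
    v (0, 0) * v (2, 0) + 2 * v (0, 1) * v (2, 2) + 2 * v (2, 1) * v (0, 2),
    v (1, 0) * v (1, 0) + 2 * v (1, 1) * v (1, 2) + 2 * v (1, 1) * v (1, 2),
    v (1, 0) * v (2, 0) + 2 * v (1, 1) * v (2, 2) + 2 * v (2, 1) * v (1, 2),
    v (2, 0) * v (2, 0) + 2 * v (2, 1) * v (2, 2) + 2 * v (2, 1) * v (2, 2),
    v (0, 0) * v (1, 1) * v (2, 2) - v (0, 0) * v (1, 2) * v (2, 1)
      - v (0, 1) * v (1, 0) * v (2, 2) + v (0, 1) * v (1, 2) * v (2, 0)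
      + v (0, 2) * v (1, 0) * v (2, 1) - v (0, 2) * v (1, 1) * v (2, 0)]

/-- The algebra map sending the seven generators to the basic invariants. -/
noncomputable def invHom : MvPolynomial (Fin 7) ℂ →ₐ[ℂ] MvPolynomial (Fin 3 × Fin 3) ℂ :=
  MvPolynomial.aeval
    ![qAdj 3 0 0, qAdj 3 0 1, qAdj 3 0 2, qAdj 3 1 1, qAdj 3 1 2, qAdj 3 2 2, cAdj]

theorem eval_invHom (v : Fin 3 × Fin 3 → ℂ) (P : MvPolynomial (Fin 7) ℂ) :
    eval v (invHom P) = eval (invVal v) P := by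
  induction P using MvPolynomial.induction_on with
  | C a => simp [invHom, MvPolynomial.algebraMap_eq]
  | add p q hp hq => simp [hp, hq]
  | mul_X p i hp =>
    rw [map_mul, map_mul, map_mul, hp]
    congr 1
    fin_cases i <;> simp [invHom, invVal, qAdj, cAdj, Matrix.det_fin_three]

theorem adjDer_invHom (ξ : Fin 3) (P : MvPolynomial (Fin 7) ℂ) :
    adjDer 3 ξ (invHom P) = 0 := by
  induction P using MvPolynomial.induction_on with
  | C a => simp [invHom]
  | add p q hp hq => simp [hp, hq]
  | mul_X p i hp =>
    rw [map_mul, Derivation.leibniz, hp, smul_zero, add_zero]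
    suffices h : adjDer 3 ξ (invHom (X i)) = 0 by rw [h, smul_zero]
    have h2 : ∀ ξ, adjDer 3 ξ 2 = 0 := fun ξ => (adjDer 3 ξ).map_natCast 2
    fin_cases i <;> fin_cases ξ <;>
      simp [invHom, qAdj, cAdj, Matrix.det_fin_three, Derivation.leibniz, adjDer_X,
        Fin.sum_univ_three, slBr, h2, map_ofNat] <;> ring

/-- Replace the first vector by the nilpotent vector with coordinates `(0, 1, 0)`. -/
def pin {A : Type*} [CommRing A] (v : Fin 3 × Fin 3 → A) : Fin 3 × Fin 3 → A :=
  fun i => if i.1 = 0 then ![0, 1, 0] i.2 else v i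

theorem invVal_pin (v : Fin 3 × Fin 3 → ℂ) : invVal (pin v) =
    ![0, 2 * v (1, 2), 2 * v (2, 2), v (1, 0) * v (1, 0) + 4 * v (1, 1) * v (1, 2),
      v (1, 0) * v (2, 0) + 2 * v (1, 1) * v (2, 2) + 2 * v (2, 1) * v (1, 2),
      v (2, 0) * v (2, 0) + 4 * v (2, 1) * v (2, 2),
      v (1, 2) * v (2, 0) - v (1, 0) * v (2, 2)] := by
  funext i
  fin_cases i <;> simp [invVal, pin] <;> ring

/-- Set the coordinates `0`, `1` and `6` to zero. -/
def trunc {A : Type*} [CommRing A] (w : Fin 7 → A) : Fin 7 → A :=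
  ![0, 0, w 2, w 3, w 4, w 5, 0]

theorem trunc_two (w : Fin 7 → ℂ) : trunc w 2 = w 2 := rfl

theorem trunc_three (w : Fin 7 → ℂ) : trunc w 3 = w 3 := rfl

theorem eval_aeval_eq {σ τ : Type*} (w : τ → ℂ) (g : σ → MvPolynomial τ ℂ)
    (P : MvPolynomial σ ℂ) : eval w (aeval g P) = eval (fun i => eval w (g i)) P := by
  induction P using MvPolynomial.induction_on with
  | C a => simp
  | add p q hp hq => rw [map_add, map_add, map_add, hp, hq]
  | mul_X p i hp => rw [map_mul, map_mul, map_mul, hp, aeval_X, eval_X]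

theorem eval_trunc (w : Fin 7 → ℂ) (P : MvPolynomial (Fin 7) ℂ) :
    eval w (aeval (trunc X) P) = eval (trunc w) P := by
  rw [eval_aeval_eq]
  congr 2
  funext i
  fin_cases i <;> simp [trunc]

theorem eval_pin (v : Fin 3 × Fin 3 → ℂ) (p : MvPolynomial (Fin 3 × Fin 3) ℂ) :
    eval v (aeval (pin X) p) = eval (pin v) p := by
  rw [eval_aeval_eq]
  congr 2
  funext ⟨i, j⟩
  fin_cases i <;> fin_cases j <;> simp [pin]

theorem exists_decomp_pin (P : MvPolynomial (Fin 7) ℂ) :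
    ∃ P₀ P₁ Q : MvPolynomial (Fin 7) ℂ, ∀ v, eval (invVal (pin v)) P =
      eval (trunc (invVal (pin v))) P₀ + invVal (pin v) 6 * eval (trunc (invVal (pin v))) P₁
        + v (1, 2) * eval (invVal (pin v)) Q := by
  induction P using MvPolynomial.induction_on with
  | C a => exact ⟨C a, 0, 0, by simp⟩
  | add p q hp hq =>
    obtain ⟨a, b, c, h⟩ := hp
    obtain ⟨a', b', c', h'⟩ := hq
    exact ⟨a + a', b + b', c + c', fun v => by simp only [map_add, h, h']; ring⟩
  | mul_X p i hp =>
    obtain ⟨a, b, c, h⟩ := hp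
    have key : ∀ j, (∀ w : Fin 7 → ℂ, trunc w j = w j) →
        ∃ P₀ P₁ Q : MvPolynomial (Fin 7) ℂ, ∀ v, eval (invVal (pin v)) (p * X j) =
          eval (trunc (invVal (pin v))) P₀
            + invVal (pin v) 6 * eval (trunc (invVal (pin v))) P₁
            + v (1, 2) * eval (invVal (pin v)) Q := fun j hj =>
      ⟨a * X j, b * X j, c * X j, fun v => by simp only [map_mul, h, eval_X, hj]; ring⟩
    match i with
    | 0 => exact ⟨0, 0, 0, fun v => by
        have e : invVal (pin v) 0 = 0 := by simp [invVal_pin]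
        simp only [map_mul, map_zero, eval_X, e]; ring⟩
    | 1 => exact ⟨0, 0, 2 * p, fun v => by
        have e : invVal (pin v) 1 = 2 * v (1, 2) := by simp [invVal_pin]
        simp only [map_mul, map_zero, eval_X, e, map_ofNat]; ring⟩
    | 2 => exact key 2 trunc_two
    | 3 => exact key 3 trunc_three
    | 4 => exact key 4 fun w => rfl
    | 5 => exact key 5 fun w => rfl
    | 6 =>
      refine ⟨C (1 / 4) * X 2 ^ 2 * X 3 * b, a,
        c * X 6 + (C (1 / 2) * X 1 * X 5 - X 2 * X 4) * aeval (trunc X) b, fun v => ?_⟩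
      simp only [map_mul, map_add, map_sub, map_pow, h, eval_X, eval_C, eval_trunc]
      have hr : invVal (pin v) 6 ^ 2 = 1 / 4 * invVal (pin v) 2 ^ 2 * invVal (pin v) 3 +
          v (1, 2) * (1 / 2 * invVal (pin v) 1 * invVal (pin v) 5
            - invVal (pin v) 2 * invVal (pin v) 4) := by
        simp [invVal_pin]; ring
      rw [trunc_two, trunc_three]
      linear_combination eval (trunc (invVal (pin v))) b * hr

theorem eq_zero_of_mul_eval {σ : Type*} {p q : MvPolynomial σ ℂ} (hq : q ≠ 0)
    (h : ∀ v, eval v q ≠ 0 → eval v p = 0) : p = 0 := by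
  have : q * p = 0 := MvPolynomial.funext fun v => by
    by_cases hv : eval v q = 0
    · simp [hv]
    · simp [h v hv]
  exact (mul_eq_zero.mp this).resolve_left hq

theorem exists_quotient_pin {f : MvPolynomial (Fin 3 × Fin 3) ℂ} {P : MvPolynomial (Fin 7) ℂ}
    (hf : ∀ v, v (1, 2) * eval v f = eval (invVal (pin v)) P) :
    ∃ Q : MvPolynomial (Fin 7) ℂ, ∀ v, eval v f = eval (invVal (pin v)) Q := by
  obtain ⟨P₀, P₁, Q, h⟩ := exists_decomp_pin P
  have key : ∀ (w : Fin 7 → ℂ) (s : ℂ), w 2 ≠ 0 → s ^ 2 = w 3 →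
      eval (trunc w) P₀ - s * w 2 / 2 * eval (trunc w) P₁ = 0 := by
    intro w s hw hs
    set v : Fin 3 × Fin 3 → ℂ := fun i =>
      ![![0, 0, 0], ![s, w 4 / w 2, 0], ![0, w 5 / (2 * w 2), w 2 / 2]] i.1 i.2 with hv
    have h1 : trunc (invVal (pin v)) = trunc w := by
      rw [invVal_pin]
      funext i
      fin_cases i <;> simp [trunc, hv] <;> field_simp
      · exact hs
      · ring
    have h2 : invVal (pin v) 6 = -(s * w 2 / 2) := by
      rw [invVal_pin]; simp [hv]; ring
    have h3 := h v
    rw [← hf, h1, h2] at h3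
    have h4 : v (1, 2) = 0 := by simp [hv]
    rw [h4] at h3
    linear_combination -h3
  have hP₀ : aeval (trunc X) P₀ = (0 : MvPolynomial (Fin 7) ℂ) := by
    refine eq_zero_of_mul_eval (q := X 2) (X_ne_zero _) fun w hw => ?_
    rw [eval_X] at hw
    obtain ⟨s, hs⟩ := IsAlgClosed.exists_pow_nat_eq (w 3) two_pos
    rw [eval_trunc]
    linear_combination (key w s hw hs + key w (-s) hw (by rw [← hs]; ring)) / 2
  have hP₁ : aeval (trunc X) P₁ = (0 : MvPolynomial (Fin 7) ℂ) := by
    refine eq_zero_of_mul_eval (q := X 2 * X 3) (mul_ne_zero (X_ne_zero _) (X_ne_zero _))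
      fun w hw => ?_
    rw [map_mul, eval_X, eval_X] at hw
    obtain ⟨hw2, hw3⟩ := mul_ne_zero_iff.mp hw
    obtain ⟨s, hs⟩ := IsAlgClosed.exists_pow_nat_eq (w 3) two_pos
    rw [eval_trunc]
    have hs0 : s ≠ 0 := by rintro rfl; simp_all
    have h5 : s * w 2 * eval (trunc w) P₁ = 0 := by
      linear_combination key w (-s) hw2 (by rw [← hs]; ring) - key w s hw2 hs
    exact (mul_eq_zero.mp h5).resolve_left (mul_ne_zero hs0 hw2)
  refine ⟨Q, ?_⟩
  have hdiff : ∀ v, v (1, 2) ≠ 0 → eval v f = eval (invVal (pin v)) Q := by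
    intro v hv
    have := h v
    rw [← hf, ← eval_trunc, ← eval_trunc, hP₀, hP₁] at this
    simpa [hv] using this
  have : f - aeval (pin X) (invHom Q) = 0 :=
    eq_zero_of_mul_eval (q := X (1, 2)) (X_ne_zero _) fun v hv => by
      rw [eval_X] at hv
      rw [map_sub, eval_pin, eval_invHom, hdiff v hv, sub_self]
  intro v
  rw [sub_eq_zero.mp this, eval_pin, eval_invHom]

theorem exists_eval_slice_s6 (p : MvPolynomial (Fin 3 × Fin 3) ℂ) :
    ∃ (N : ℕ) (P : MvPolynomial (Fin 7) ℂ), ∀ v : Fin 3 × Fin 3 → ℂ, v (1, 2) ≠ 0 →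
      v (1, 2) ^ N * eval (flowY (-v (1, 0) / (2 * v (1, 2))) (pin v)) p
        = eval (invVal (pin v)) P := by
  induction p using MvPolynomial.induction_on with
  | C a => exact ⟨0, C a, by simp⟩
  | add p q hp hq =>
    obtain ⟨N, P, h⟩ := hp
    obtain ⟨M, Q, h'⟩ := hq
    refine ⟨N + M, (C (1 / 2) * X 1) ^ M * P + (C (1 / 2) * X 1) ^ N * Q, fun v hv => ?_⟩
    have e : 1 / 2 * invVal (pin v) 1 = v (1, 2) := by simp [invVal_pin]
    simp only [map_add, map_mul, map_pow, eval_C, eval_X, e, ← h v hv, ← h' v hv]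
    ring
  | mul_X p i hp =>
    obtain ⟨N, P, h⟩ := hp
    suffices hG : ∃ G : MvPolynomial (Fin 7) ℂ, ∀ v : Fin 3 × Fin 3 → ℂ, v (1, 2) ≠ 0 →
        v (1, 2) ^ 2 * flowY (-v (1, 0) / (2 * v (1, 2))) (pin v) i = eval (invVal (pin v)) G by
      obtain ⟨G, hG⟩ := hG
      refine ⟨N + 2, P * G, fun v hv => ?_⟩
      rw [map_mul, map_mul, eval_X, ← h v hv, ← hG v hv]
      ring
    obtain ⟨i, j⟩ := i
    fin_cases i <;> fin_cases j
    · exact ⟨0, fun v hv => by simp [flowY, pin]⟩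
    · exact ⟨C (1 / 4) * X 1 ^ 2, fun v hv => by simp [flowY, pin, invVal_pin]; ring⟩
    · exact ⟨0, fun v hv => by simp [flowY, pin]⟩
    · exact ⟨0, fun v hv => by simp [flowY, pin]; field_simp; simp⟩
    · exact ⟨C (1 / 8) * X 1 * X 3, fun v hv => by
        simp [flowY, pin, invVal_pin]; field_simp; ring⟩
    · exact ⟨C (1 / 8) * X 1 ^ 3, fun v hv => by simp [flowY, pin, invVal_pin]; ring⟩
    · exact ⟨C (1 / 2) * X 1 * X 6, fun v hv => by
        simp [flowY, pin, invVal_pin]; field_simp; ring⟩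
    · exact ⟨C (1 / 4) * X 1 * X 4 - C (1 / 8) * X 3 * X 2, fun v hv => by
        simp [flowY, pin, invVal_pin]; field_simp; ring⟩
    · exact ⟨C (1 / 8) * X 1 ^ 2 * X 2, fun v hv => by simp [flowY, pin, invVal_pin]; ring⟩

theorem exists_eval_pin {p : MvPolynomial (Fin 3 × Fin 3) ℂ} (hp : adjDer 3 2 p = 0) :
    ∃ Q : MvPolynomial (Fin 7) ℂ, ∀ v, eval (pin v) p = eval (invVal (pin v)) Q := by
  obtain ⟨N, P, h⟩ := exists_eval_slice_s6 p
  have h1 : ∃ Q : MvPolynomial (Fin 7) ℂ, ∀ v,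
      eval v (X (1, 2) ^ (N + 1) * aeval (pin X) p) = eval (invVal (pin v)) Q := by
    refine ⟨C (1 / 2) * X 1 * P, fun v => ?_⟩
    have e : 1 / 2 * invVal (pin v) 1 = v (1, 2) := by simp [invVal_pin]
    simp only [map_mul, map_pow, eval_C, eval_X, e, eval_pin]
    by_cases hv : v (1, 2) = 0
    · simp [hv]
    · rw [← h v hv, eval_flowY hp]
      ring
  have h2 : ∀ n, (∃ Q : MvPolynomial (Fin 7) ℂ, ∀ v,
      eval v (X (1, 2) ^ n * aeval (pin X) p) = eval (invVal (pin v)) Q) →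
      ∃ Q : MvPolynomial (Fin 7) ℂ, ∀ v,
        eval v (aeval (pin X) p) = eval (invVal (pin v)) Q := by
    intro n
    induction n with
    | zero => simp
    | succ n ih =>
      rintro ⟨Q, hQ⟩
      exact ih (exists_quotient_pin (P := Q) fun v => by rw [← hQ, pow_succ']; simp [mul_assoc])
  simpa only [eval_pin] using h2 _ h1

theorem eval_eq_zero_of_null {g : MvPolynomial (Fin 3 × Fin 3) ℂ}
    (h1 : adjDer 3 1 g = 0) (h2 : adjDer 3 2 g = 0) (hg : ∀ v, eval (pin v) g = 0)
    {a b : ℂ} (hb : b ≠ 0) {w : Fin 3 × Fin 3 → ℂ} (hw0 : w (0, 0) = -2 * a * b)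
    (hw1 : w (0, 1) = a ^ 2) (hw2 : w (0, 2) = -b ^ 2) : eval w g = 0 := by
  rw [← eval_flowY h2 ((1 - a) / b) w, ← eval_flowX h1 (-b)]
  have : flowX (-b) (flowY ((1 - a) / b) w) = pin (flowX (-b) (flowY ((1 - a) / b) w)) := by
    funext ⟨i, j⟩
    fin_cases i
    · fin_cases j <;> simp [pin, flowX, flowY, hw0, hw1, hw2] <;> field_simp <;> ring
    · rfl
    · rfl
  rw [this, hg]

theorem exists_decomp_qAdj (p : MvPolynomial (Fin 3 × Fin 3) ℂ) :
    ∃ k r₀ r₁ : MvPolynomial (Fin 3 × Fin 3) ℂ, p = qAdj 3 0 0 * k +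
      aeval (Function.update X (0, 0) 0) r₀ + X (0, 0) * aeval (Function.update X (0, 0) 0) r₁ := by
  induction p using MvPolynomial.induction_on with
  | C a => exact ⟨0, C a, 0, by simp⟩
  | add p q hp hq =>
    obtain ⟨a, b, c, h⟩ := hp
    obtain ⟨a', b', c', h'⟩ := hq
    refine ⟨a + a', b + b', c + c', ?_⟩
    rw [map_add, map_add, h, h']
    ring
  | mul_X p i hp =>
    obtain ⟨a, b, c, h⟩ := hp
    by_cases hi : i = (0, 0)
    · subst hi
      refine ⟨a * X (0, 0) + aeval (Function.update X (0, 0) 0) c,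
        -4 * X (0, 1) * X (0, 2) * c, b, ?_⟩
      have e1 : aeval (Function.update X (0, 0) 0) (-4 * X (0, 1) * X (0, 2) * c) =
          -4 * X (0, 1) * X (0, 2) * (aeval (Function.update X (0, 0) 0) c :
            MvPolynomial (Fin 3 × Fin 3) ℂ) := by
        rw [map_mul, map_mul, map_mul, map_neg, map_ofNat, aeval_X, aeval_X,
          Function.update_of_ne (by decide), Function.update_of_ne (by decide)]
      rw [e1]
      nth_rw 1 [h]
      rw [qAdj]
      ring
    · refine ⟨a * X i, b * X i, c * X i, ?_⟩
      rw [map_mul, map_mul, aeval_X, Function.update_of_ne hi]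
      nth_rw 1 [h]
      ring

theorem eval_aeval_update {σ : Type*} [DecidableEq σ] (i : σ) (v : σ → ℂ) (p : MvPolynomial σ ℂ) :
    eval v (aeval (Function.update X i 0) p) = eval (Function.update v i 0) p := by
  rw [eval_aeval_eq]
  congr 2
  funext j
  by_cases h : j = i
  · subst h; simp
  · simp [h]

theorem qAdj_dvd {g : MvPolynomial (Fin 3 × Fin 3) ℂ}
    (h1 : adjDer 3 1 g = 0) (h2 : adjDer 3 2 g = 0) (hg : ∀ v, eval (pin v) g = 0) :
    qAdj 3 0 0 ∣ g := by
  obtain ⟨k, r₀, r₁, h⟩ := exists_decomp_qAdj g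
  have key : ∀ (v : Fin 3 × Fin 3 → ℂ) (a b : ℂ), b ≠ 0 → v (0, 1) = a ^ 2 → v (0, 2) = -b ^ 2 →
      eval (Function.update v (0, 0) 0) r₀
        - 2 * a * b * eval (Function.update v (0, 0) 0) r₁ = 0 := by
    intro v a b hb ha' hb'
    have h0 : eval (Function.update v (0, 0) (-2 * a * b)) g = 0 :=
      eval_eq_zero_of_null (a := a) h1 h2 hg hb (by simp) (by simpa using ha') (by simpa using hb')
    rw [h] at h0
    simp only [map_add, map_mul, eval_aeval_update, Function.update_idem, eval_X,
      Function.update_self] at h0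
    have hq : eval (Function.update v (0, 0) (-2 * a * b)) (qAdj 3 0 0) = 0 := by
      simp [qAdj, ha', hb']; ring
    rw [hq] at h0
    linear_combination h0
  have hr₀ : aeval (Function.update X (0, 0) 0) r₀ = (0 : MvPolynomial (Fin 3 × Fin 3) ℂ) := by
    refine eq_zero_of_mul_eval (q := X (0, 2)) (X_ne_zero _) fun v hv => ?_
    rw [eval_X] at hv
    obtain ⟨a, ha⟩ := IsAlgClosed.exists_pow_nat_eq (v (0, 1)) two_pos
    obtain ⟨b, hb⟩ := IsAlgClosed.exists_pow_nat_eq (-v (0, 2)) two_pos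
    have hb0 : b ≠ 0 := by rintro rfl; simp_all
    rw [eval_aeval_update]
    linear_combination (key v a b hb0 ha.symm (by rw [hb, neg_neg]) +
      key v a (-b) (neg_ne_zero.mpr hb0) ha.symm (by rw [neg_sq, hb, neg_neg])) / 2
  have hr₁ : aeval (Function.update X (0, 0) 0) r₁ = (0 : MvPolynomial (Fin 3 × Fin 3) ℂ) := by
    refine eq_zero_of_mul_eval (q := X (0, 1) * X (0, 2))
      (mul_ne_zero (X_ne_zero _) (X_ne_zero _)) fun v hv => ?_
    rw [map_mul, eval_X, eval_X] at hv
    obtain ⟨hx, hy⟩ := mul_ne_zero_iff.mp hv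
    obtain ⟨a, ha⟩ := IsAlgClosed.exists_pow_nat_eq (v (0, 1)) two_pos
    obtain ⟨b, hb⟩ := IsAlgClosed.exists_pow_nat_eq (-v (0, 2)) two_pos
    have ha0 : a ≠ 0 := by rintro rfl; simp_all
    have hb0 : b ≠ 0 := by rintro rfl; simp_all
    rw [eval_aeval_update]
    have : a * b * eval (Function.update v (0, 0) 0) r₁ = 0 := by
      linear_combination (key v a (-b) (neg_ne_zero.mpr hb0) ha.symm
        (by rw [neg_sq, hb, neg_neg]) - key v a b hb0 ha.symm (by rw [hb, neg_neg])) / 4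
    exact (mul_eq_zero.mp this).resolve_left (mul_ne_zero ha0 hb0)
  exact ⟨k, by rw [h, hr₀, hr₁]; ring⟩

theorem isHomogeneous_adjDer {m n : ℕ} (ξ : Fin 3) {p : MvPolynomial (Fin m × Fin 3) ℂ}
    (hp : p.IsHomogeneous n) : (adjDer m ξ p).IsHomogeneous n := by
  rw [p.as_sum, map_sum]
  refine IsHomogeneous.sum _ _ _ fun s hs => ?_
  have hs' : s.degree = n := by
    rw [Finsupp.degree_eq_weight_one]
    exact hp (mem_support_iff.mp hs)
  rw [adjDer, mkDerivation_monomial, smul_eq_C_mul, ← zero_add n]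
  refine (isHomogeneous_C _ _).mul (IsHomogeneous.sum _ _ _ fun i hi => ?_)
  have hle : Finsupp.single i 1 ≤ s := by
    rw [Finsupp.single_le_iff]
    exact Nat.one_le_iff_ne_zero.mpr (Finsupp.mem_support_iff.mp hi)
  have hn : (s - Finsupp.single i 1).degree + 1 = n := by
    rw [← hs']
    conv_rhs => rw [← tsub_add_cancel_of_le hle]
    simp
  rw [← hn]
  refine (isHomogeneous_monomial _ rfl).mul (IsHomogeneous.sum _ _ _ fun θ _ => ?_)
  rw [← zero_add 1]
  exact (isHomogeneous_C _ _).mul (isHomogeneous_X _ _)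

theorem adjDer_homogeneousComponent {m : ℕ} (ξ : Fin 3) {p : MvPolynomial (Fin m × Fin 3) ℂ}
    (hp : adjDer m ξ p = 0) (n : ℕ) : adjDer m ξ (homogeneousComponent n p) = 0 := by
  by_cases hn : n ∈ Finset.range (p.totalDegree + 1)
  · have h : homogeneousComponent n (adjDer m ξ p) = adjDer m ξ (homogeneousComponent n p) := by
      conv_lhs => rw [← sum_homogeneousComponent p, map_sum, map_sum]
      rw [Finset.sum_eq_single n]
      · rw [homogeneousComponent_of_mem (isHomogeneous_adjDer ξ
          (homogeneousComponent_isHomogeneous n p)), if_pos rfl]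
      · intro j _ hj
        rw [homogeneousComponent_of_mem (isHomogeneous_adjDer ξ
          (homogeneousComponent_isHomogeneous j p)), if_neg hj.symm]
      · exact fun h => absurd hn h
    rw [← h, hp, map_zero]
  · rw [homogeneousComponent_eq_zero n p (by simpa using hn), map_zero]

theorem isHomogeneous_qAdj (m : ℕ) (i j : Fin m) : (qAdj m i j).IsHomogeneous 2 := by
  have hX : ∀ a b : Fin m × Fin 3, (X a * X b : MvPolynomial _ ℂ).IsHomogeneous 2 := fun a b =>
    (isHomogeneous_X ℂ a).mul (isHomogeneous_X ℂ b)
  have h2 : ∀ a b : Fin m × Fin 3, (2 * X a * X b : MvPolynomial _ ℂ).IsHomogeneous 2 := by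
    intro a b
    rw [mul_assoc, two_mul]
    exact (hX a b).add (hX a b)
  exact ((hX _ _).add (h2 _ _)).add (h2 _ _)

theorem isHomogeneous_cAdj : cAdj.IsHomogeneous 3 := by
  have hX : ∀ a b c : Fin 3 × Fin 3, (X a * X b * X c : MvPolynomial _ ℂ).IsHomogeneous 3 :=
    fun a b c => ((isHomogeneous_X ℂ a).mul (isHomogeneous_X ℂ b)).mul (isHomogeneous_X ℂ c)
  rw [cAdj, Matrix.det_fin_three]
  exact (((((hX _ _ _).sub (hX _ _ _)).sub (hX _ _ _)).add (hX _ _ _)).add (hX _ _ _)).sub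
    (hX _ _ _)

theorem homogeneousComponent_invHom_mem (n : ℕ) (P : MvPolynomial (Fin 7) ℂ) :
    homogeneousComponent n (invHom P) ∈ invHom.range := by
  rw [P.as_sum, map_sum, map_sum]
  refine sum_mem fun s _ => ?_
  have hs : ∃ k, (invHom (monomial s (coeff s P))).IsHomogeneous k := by
    have hg : ∀ i : Fin 7, (invHom (X i)).IsHomogeneous (![2, 2, 2, 2, 2, 2, 3] i) := by
      intro i
      rw [invHom, aeval_X]
      fin_cases i
      · exact isHomogeneous_qAdj _ _ _
      · exact isHomogeneous_qAdj _ _ _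
      · exact isHomogeneous_qAdj _ _ _
      · exact isHomogeneous_qAdj _ _ _
      · exact isHomogeneous_qAdj _ _ _
      · exact isHomogeneous_qAdj _ _ _
      · exact isHomogeneous_cAdj
    rw [monomial_eq, map_mul, Finsupp.prod, map_prod]
    refine ⟨_, IsHomogeneous.mul (m := 0) ?_ (IsHomogeneous.prod _ _
      (fun i => ![2, 2, 2, 2, 2, 2, 3] i * s i) fun i _ => ?_)⟩
    · rw [← algebraMap_eq, AlgHom.commutes, algebraMap_eq]
      exact isHomogeneous_C _ _
    · rw [map_pow]
      exact (hg i).pow _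
  obtain ⟨k, hk⟩ := hs
  rw [homogeneousComponent_of_mem hk]
  split_ifs
  · exact ⟨_, rfl⟩
  · exact zero_mem _

theorem mem_range_of_isHomogeneous (n : ℕ) : ∀ p : MvPolynomial (Fin 3 × Fin 3) ℂ,
    p.IsHomogeneous n → (∀ ξ, adjDer 3 ξ p = 0) → p ∈ invHom.range := by
  induction n using Nat.strong_induction_on with
  | _ n ih =>
  intro p hpn hp
  obtain ⟨Q, hQ⟩ := exists_eval_pin (hp 2)
  have hg : ∀ ξ, adjDer 3 ξ (p - invHom Q) = 0 := fun ξ => by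
    rw [map_sub, hp, adjDer_invHom, sub_zero]
  obtain ⟨k, hk⟩ := qAdj_dvd (hg 1) (hg 2) fun v => by
    rw [map_sub, eval_invHom, hQ, sub_self]
  have hq : invHom (X 0) = qAdj 3 0 0 := by simp [invHom]
  have hq0 : qAdj 3 0 0 ≠ 0 := fun h => by
    have := congrArg (eval fun _ => 1) h
    norm_num [qAdj] at this
  have hkinv : ∀ ξ, adjDer 3 ξ k = 0 := fun ξ => by
    have := hg ξ
    rw [hk, Derivation.leibniz, ← hq, adjDer_invHom, smul_zero, add_zero, hq, smul_eq_mul] at this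
    exact (mul_eq_zero.mp this).resolve_left hq0
  have hcomp : p = homogeneousComponent n (invHom Q) +
      homogeneousComponent n (qAdj 3 0 0 * k) := by
    rw [← map_add, ← hk, add_sub_cancel, homogeneousComponent_of_mem hpn, if_pos rfl]
  rw [hcomp]
  refine add_mem (homogeneousComponent_invHom_mem _ _) ?_
  rw [← sum_homogeneousComponent k, Finset.mul_sum, map_sum]
  refine sum_mem fun i _ => ?_
  rw [homogeneousComponent_of_mem
    ((isHomogeneous_qAdj 3 0 0).mul (homogeneousComponent_isHomogeneous i k))]
  split_ifs with hi
  · exact mul_mem ⟨X 0, hq⟩ (ih i (by omega) _ (homogeneousComponent_isHomogeneous i k)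
      fun ξ => adjDer_homogeneousComponent ξ (hkinv ξ) i)
  · exact zero_mem _

theorem mem_range_invHom_iff (p : MvPolynomial (Fin 3 × Fin 3) ℂ) :
    (∀ ξ, adjDer 3 ξ p = 0) ↔ p ∈ invHom.range := by
  constructor
  · intro hp
    rw [← sum_homogeneousComponent p]
    exact sum_mem fun i _ => mem_range_of_isHomogeneous i _
      (homogeneousComponent_isHomogeneous i p) fun ξ => adjDer_homogeneousComponent ξ (hp ξ) i
  · rintro ⟨P, rfl⟩ ξ
    exact adjDer_invHom ξ P

/-- The Gram determinant in the seven generators. -/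
noncomputable def gramDet : MvPolynomial (Fin 7) ℂ :=
  Matrix.det !![X 0, X 1, X 2; X 1, X 3, X 4; X 2, X 4, X 5]

theorem eval_gramDet (w : Fin 7 → ℂ) : eval w gramDet =
    w 0 * w 3 * w 5 - w 0 * w 4 * w 4 - w 1 * w 1 * w 5 + w 1 * w 4 * w 2
      + w 2 * w 1 * w 4 - w 2 * w 3 * w 2 := by
  simp [gramDet, Matrix.det_fin_three]

theorem invVal_six_sq (v : Fin 3 × Fin 3 → ℂ) :
    invVal v 6 ^ 2 = -(1 / 4) * eval (invVal v) gramDet := by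
  rw [eval_gramDet]
  simp [invVal]
  ring

theorem exists_decomp_relation (P : MvPolynomial (Fin 7) ℂ) :
    ∃ P₀ P₁ Q : MvPolynomial (Fin 7) ℂ, P = aeval (Function.update X 6 0) P₀ +
      X 6 * aeval (Function.update X 6 0) P₁ + (X 6 ^ 2 + C (1 / 4) * gramDet) * Q := by
  induction P using MvPolynomial.induction_on with
  | C a => exact ⟨C a, 0, 0, by simp⟩
  | add p q hp hq =>
    obtain ⟨a, b, c, h⟩ := hp
    obtain ⟨a', b', c', h'⟩ := hq
    refine ⟨a + a', b + b', c + c', ?_⟩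
    rw [map_add, map_add, h, h']
    ring
  | mul_X p i hp =>
    obtain ⟨a, b, c, h⟩ := hp
    by_cases hi : i = 6
    · subst hi
      refine ⟨-(C (1 / 4) * gramDet * b), a,
        c * X 6 + aeval (Function.update X 6 0) b, ?_⟩
      have e : aeval (Function.update X 6 0) gramDet = gramDet := by
        refine MvPolynomial.funext fun w => ?_
        rw [eval_aeval_update, eval_gramDet, eval_gramDet]
        simp
      have e1 : aeval (Function.update X 6 0) (-(C (1 / 4) * gramDet * b)) =
          -(C (1 / 4) * gramDet * (aeval (Function.update X 6 0) b : MvPolynomial (Fin 7) ℂ)) := by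
        rw [map_neg, map_mul, map_mul, e, aeval_C, algebraMap_eq]
      rw [e1]
      nth_rw 1 [h]
      ring
    · refine ⟨a * X i, b * X i, c * X i, ?_⟩
      rw [map_mul, map_mul, aeval_X, Function.update_of_ne hi]
      nth_rw 1 [h]
      ring

theorem exists_invVal_eq (w : Fin 7 → ℂ) (h0 : w 0 ≠ 0) (h1 : w 0 * w 3 - w 1 ^ 2 ≠ 0) :
    ∃ v, Function.update (invVal v) 6 0 = Function.update w 6 0 := by
  obtain ⟨s, hs⟩ := IsAlgClosed.exists_pow_nat_eq (w 0) two_pos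
  have hs0 : s ≠ 0 := by rintro rfl; simp_all
  obtain ⟨u, hu⟩ := IsAlgClosed.exists_pow_nat_eq (w 3 - (w 1 / s) ^ 2) two_pos
  have hu0 : u ≠ 0 := by
    rintro rfl
    apply h1
    rw [← hs]
    field_simp at hu
    linear_combination -hu
  obtain ⟨t, ht⟩ : ∃ t, t * s = w 1 := ⟨w 1 / s, by field_simp⟩
  obtain ⟨y, hy⟩ : ∃ y, y * s = w 2 := ⟨w 2 / s, by field_simp⟩
  obtain ⟨z, hz⟩ : ∃ z, z * u = w 4 - t * y := ⟨(w 4 - t * y) / u, by field_simp⟩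
  obtain ⟨r, hr⟩ := IsAlgClosed.exists_pow_nat_eq (w 5 - y ^ 2 - z ^ 2) two_pos
  rw [← ht, mul_div_cancel_right₀ _ hs0] at hu
  refine ⟨fun i => ![![s, 0, 0], ![t, u / 2, u / 2],
    ![y, (z + Complex.I * r) / 2, (z - Complex.I * r) / 2]] i.1 i.2, ?_⟩
  funext i
  fin_cases i <;> simp [invVal]
  · linear_combination hs
  · linear_combination ht
  · linear_combination hy
  · linear_combination hu
  · linear_combination hz
  · linear_combination hr - r ^ 2 * Complex.I_sq

theorem invHom_eq_zero_iff (P : MvPolynomial (Fin 7) ℂ) :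
    invHom P = 0 ↔ X 6 ^ 2 + C (1 / 4) * gramDet ∣ P := by
  constructor
  · intro hP
    obtain ⟨P₀, P₁, Q, h⟩ := exists_decomp_relation P
    have key : ∀ v, eval (Function.update (invVal v) 6 0) P₀ +
        invVal v 6 * eval (Function.update (invVal v) 6 0) P₁ = 0 := by
      intro v
      have h0 : eval (invVal v) P = 0 := by rw [← eval_invHom, hP, map_zero]
      rw [h] at h0
      simp only [map_add, map_mul, map_pow, eval_aeval_update, eval_X, eval_C,
        invVal_six_sq] at h0
      linear_combination h0
    have key' : ∀ v, eval (Function.update (invVal v) 6 0) P₀ -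
        invVal v 6 * eval (Function.update (invVal v) 6 0) P₁ = 0 := by
      intro v
      have e1 : Function.update (invVal (-v)) 6 0 = Function.update (invVal v) 6 0 := by
        funext i
        fin_cases i <;> simp [invVal]
      have e2 : invVal (-v) 6 = -invVal v 6 := by
        simp [invVal]; ring
      have := key (-v)
      rw [e1, e2] at this
      linear_combination this
    have hm : eval ![1, 0, 0, 1, 0, 1, 0] (X 0 * (X 0 * X 3 - X 1 ^ 2) * gramDet) ≠ (0 : ℂ) := by
      simp [eval_gramDet]
    have hm0 : X 0 * (X 0 * X 3 - X 1 ^ 2) * gramDet ≠ 0 := fun h => hm (by rw [h, map_zero])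
    have hv : ∀ w, eval w (X 0 * (X 0 * X 3 - X 1 ^ 2) * gramDet) ≠ (0 : ℂ) →
        eval (Function.update w 6 0) P₀ = 0 ∧ eval (Function.update w 6 0) P₁ = 0 := by
      intro w hw
      simp only [map_mul, map_sub, map_pow, eval_X, mul_ne_zero_iff] at hw
      obtain ⟨v, hv⟩ := exists_invVal_eq w hw.1.1 hw.1.2
      have hg : eval (invVal v) gramDet = eval w gramDet := by
        have hi : ∀ i : Fin 7, i ≠ 6 → invVal v i = w i := fun i hi => by
          simpa [hi] using congrFun hv i
        simp only [eval_gramDet]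
        rw [hi 0 (by decide), hi 1 (by decide), hi 2 (by decide), hi 3 (by decide),
          hi 4 (by decide), hi 5 (by decide)]
      have hc : invVal v 6 ≠ 0 := fun h => by
        have := invVal_six_sq v
        rw [hg, h] at this
        apply hw.2
        linear_combination 4 * this
      have k := key v
      have k' := key' v
      rw [hv] at k k'
      refine ⟨by linear_combination (k + k') / 2, ?_⟩
      have : invVal v 6 * eval (Function.update w 6 0) P₁ = 0 := by
        linear_combination (k - k') / 2
      exact (mul_eq_zero.mp this).resolve_left hc
    have hP₀ : aeval (Function.update X 6 0) P₀ = (0 : MvPolynomial (Fin 7) ℂ) :=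
      eq_zero_of_mul_eval hm0 fun w hw => by rw [eval_aeval_update, (hv w hw).1]
    have hP₁ : aeval (Function.update X 6 0) P₁ = (0 : MvPolynomial (Fin 7) ℂ) :=
      eq_zero_of_mul_eval hm0 fun w hw => by rw [eval_aeval_update, (hv w hw).2]
    exact ⟨Q, by rw [h, hP₀, hP₁]; ring⟩
  · rintro ⟨Q, rfl⟩
    refine MvPolynomial.funext fun v => ?_
    rw [eval_invHom]
    simp [invVal_six_sq]

/-- `ℂ[V ⊕ V ⊕ V]^{SL₂}` (`V` the adjoint representation, invariants with respect to
the `sl₂`-derivation action) is generated by the six quadratics `q_{ij}` and the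
cubic `c_{123}`, and the ideal of relations among these seven generators is
principal, generated by `c_{123}² + (1/4)·det [[q_{11},q_{12},q_{13}],
[q_{12},q_{22},q_{23}],[q_{13},q_{23},q_{33}]]`. -/
theorem stmt_6 :
    letI F : MvPolynomial (Fin 7) ℂ →ₐ[ℂ] MvPolynomial (Fin 3 × Fin 3) ℂ :=
      MvPolynomial.aeval
        ![qAdj 3 0 0, qAdj 3 0 1, qAdj 3 0 2, qAdj 3 1 1, qAdj 3 1 2, qAdj 3 2 2, cAdj]
    (∀ p : MvPolynomial (Fin 3 × Fin 3) ℂ,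
      (∀ ξ : Fin 3, adjDer 3 ξ p = 0) ↔ p ∈ F.range) ∧
    RingHom.ker F.toRingHom =
      Ideal.span {(X 6) ^ 2 + C (1/4 : ℂ) *
        Matrix.det !![(X 0 : MvPolynomial (Fin 7) ℂ), X 1, X 2;
                      X 1, X 3, X 4;
                      X 2, X 4, X 5]} := by
  refine ⟨mem_range_invHom_iff, ?_⟩
  ext P
  rw [Ideal.mem_span_singleton]
  exact invHom_eq_zero_iff P
end

section
/- Let g = sl₂(ℂ) act diagonally on W = V ⊕ V, V the adjoint representation, and consider the arc space ring O(J_∞(W)) = ℂ[(a^ξ_i)^{(k)} : ξ ∈ {h,x,y}, i ∈ {1,2}, k ≥ 0] with the induced g[t]-action. Then the invariant ring O(J_∞(W))^{g[t]} is generated as a ℂ-algebra by the elements D^k(q_{11}), D^k(q_{12}), D^k(q_{22}) for k ≥ 0, where q_{ij} = a^h_i a^h_j + 2 a^x_i a^y_j + 2 a^x_j a^y_i and D is the jet derivation. -/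
open MvPolynomial

/-- The jet action of `ξ t^r ∈ sl₂[t]` on the arc space ring
`O(J_∞(V^{⊕m})) = ℂ[(a^η_i)^{(k)}]` of `m` copies of the adjoint representation:
on generators, `(ξ t^r)(u^{(k)}) = (k!/(k−r)!)(ξ·u)^{(k−r)}`, where
`ξ · a^η_i = a^{[ξ,η]}_i`. -/
noncomputable def arcDer (m : ℕ) (ξ : Fin 3) (r : ℕ) :
    Derivation ℂ (MvPolynomial ((Fin m × Fin 3) × ℕ) ℂ)
      (MvPolynomial ((Fin m × Fin 3) × ℕ) ℂ) :=
  MvPolynomial.mkDerivation ℂ fun v =>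
    (v.2.descFactorial r : ℂ) •
      ∑ θ : Fin 3, C (slBr ξ v.1.2 θ) * X ((v.1.1, θ), v.2 - r)

/-- The jet derivation `D`, with `D(u^{(k)}) = u^{(k+1)}`. -/
noncomputable def arcD (m : ℕ) :
    Derivation ℂ (MvPolynomial ((Fin m × Fin 3) × ℕ) ℂ)
      (MvPolynomial ((Fin m × Fin 3) × ℕ) ℂ) :=
  MvPolynomial.mkDerivation ℂ fun v => X (v.1, v.2 + 1)

/-- The weight-zero quadratic `q_{ij} = a^h_i a^h_j + 2 a^x_i a^y_j + 2 a^x_j a^y_i`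
in the arc space ring. -/
noncomputable def arcQ (m : ℕ) (i j : Fin m) :
    MvPolynomial ((Fin m × Fin 3) × ℕ) ℂ :=
  X ((i, 0), 0) * X ((j, 0), 0) + 2 * X ((i, 1), 0) * X ((j, 2), 0)
    + 2 * X ((j, 1), 0) * X ((i, 2), 0)

open scoped PowerSeries Nat

theorem PowerSeries.exists_sq_eq_of_constantCoeff_ne_zero {f : ℂ⟦X⟧}
    (hf : PowerSeries.constantCoeff f ≠ 0) : ∃ g : ℂ⟦X⟧, g ^ 2 = f := by
  obtain ⟨c, hc⟩ := IsAlgClosed.exists_pow_nat_eq (PowerSeries.constantCoeff f) (n := 2) (by norm_num)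
  set a : ℂ⟦X⟧ := PowerSeries.C (PowerSeries.constantCoeff f)⁻¹ * f - 1 with ha
  have hs : PowerSeries.HasSubst a := by
    apply PowerSeries.HasSubst.of_constantCoeff_zero'
    simp [ha, hf]
  have h1 : PowerSeries.binomialSeries ℂ (1 / 2 : ℚ) ^ 2 = 1 + PowerSeries.X := by
    rw [sq, ← PowerSeries.binomialSeries_add]
    have := PowerSeries.binomialSeries_nat (R := ℚ) (A := ℂ) 1
    norm_num at this ⊢
    exact this
  have h2 := congrArg (PowerSeries.substAlgHom (R := ℂ) hs) h1
  rw [map_pow, map_add, map_one, PowerSeries.substAlgHom_X] at h2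
  refine ⟨PowerSeries.C c * PowerSeries.substAlgHom (R := ℂ) hs
    (PowerSeries.binomialSeries ℂ (1 / 2 : ℚ)), ?_⟩
  rw [mul_pow, h2, ← map_pow, hc, ha]
  have h3 : PowerSeries.C (PowerSeries.constantCoeff f) *
      PowerSeries.C (PowerSeries.constantCoeff f)⁻¹ = (1 : ℂ⟦X⟧) := by
    rw [← map_mul, mul_inv_cancel₀ hf, map_one]
  linear_combination f * h3

/-- Evaluation of an arc polynomial at an arc: `(a^η_i)^{(k)}` goes to the value at `0` of the
`k`-th derivative of the power series `u i η`. -/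
noncomputable def arcEval {m : ℕ} (u : Fin m → Fin 3 → ℂ⟦X⟧) :
    MvPolynomial ((Fin m × Fin 3) × ℕ) ℂ →ₐ[ℂ] ℂ :=
  aeval fun v => (v.2 ! : ℂ) * PowerSeries.coeff v.2 (u v.1.1 v.1.2)

/-- The Taylor expansion of an arc polynomial along an arc. -/
noncomputable def arcTaylor {m : ℕ} (u : Fin m → Fin 3 → ℂ⟦X⟧) :
    MvPolynomial ((Fin m × Fin 3) × ℕ) ℂ →ₐ[ℂ] ℂ⟦X⟧ :=
  aeval fun v => (PowerSeries.derivative ℂ)^[v.2] (u v.1.1 v.1.2)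

theorem arcTaylor_arcD {m : ℕ} (u : Fin m → Fin 3 → ℂ⟦X⟧)
    (p : MvPolynomial ((Fin m × Fin 3) × ℕ) ℂ) :
    arcTaylor u (arcD m p) = PowerSeries.derivative ℂ (arcTaylor u p) := by
  induction p using MvPolynomial.induction_on with
  | C a =>
    rw [MvPolynomial.derivation_C, ← MvPolynomial.algebraMap_eq, AlgHom.commutes, map_zero,
      Derivation.map_algebraMap]
  | add p q hp hq => simp only [map_add, hp, hq]
  | mul_X p v hp =>
    have hX : arcTaylor u (arcD m (X v)) = PowerSeries.derivative ℂ (arcTaylor u (X v)) := by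
      simp [arcD, arcTaylor, mkDerivation_X, Function.iterate_succ_apply']
    rw [Derivation.leibniz, map_mul, Derivation.leibniz, map_add, smul_eq_mul, smul_eq_mul,
      map_mul, map_mul, hX, hp, smul_eq_mul, smul_eq_mul]

theorem constantCoeff_arcTaylor {m : ℕ} (u : Fin m → Fin 3 → ℂ⟦X⟧)
    (p : MvPolynomial ((Fin m × Fin 3) × ℕ) ℂ) :
    PowerSeries.constantCoeff (arcTaylor u p) = arcEval u p := by
  induction p using MvPolynomial.induction_on with
  | C a =>
    rw [← MvPolynomial.algebraMap_eq, AlgHom.commutes, AlgHom.commutes]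
    simp
  | add p q hp hq => simp only [map_add, hp, hq]
  | mul_X p v hp =>
    rw [map_mul, map_mul, hp, map_mul]
    congr 1
    simp only [arcTaylor, arcEval, aeval_X]
    rw [PowerSeries.constantCoeff_iterate_derivative]

/-- The invariant bilinear form `q_{ij}` on power series. -/
noncomputable def arcForm (v w : Fin 3 → ℂ⟦X⟧) : ℂ⟦X⟧ :=
  v 0 * w 0 + 2 * v 1 * w 2 + 2 * w 1 * v 2

theorem arcTaylor_arcQ {m : ℕ} (u : Fin m → Fin 3 → ℂ⟦X⟧) (i j : Fin m) :
    arcTaylor u (arcQ m i j) = arcForm (u i) (u j) := by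
  simp [arcTaylor, arcQ, arcForm]

theorem arcEval_iterate_arcD_arcQ {m : ℕ} (u : Fin m → Fin 3 → ℂ⟦X⟧) (k : ℕ) (i j : Fin m) :
    arcEval u ((arcD m)^[k] (arcQ m i j)) =
      k ! * PowerSeries.coeff k (arcForm (u i) (u j)) := by
  have h : arcTaylor u ((arcD m)^[k] (arcQ m i j)) =
      (PowerSeries.derivative ℂ)^[k] (arcForm (u i) (u j)) := by
    rw [← arcTaylor_arcQ]
    exact (Function.Semiconj.iterate_right (f := arcTaylor u) (fun p => arcTaylor_arcD u p) k) _
  rw [← constantCoeff_arcTaylor, h, PowerSeries.constantCoeff_iterate_derivative]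

theorem eq_of_forall_arcEval_eq {m : ℕ} {p q : MvPolynomial ((Fin m × Fin 3) × ℕ) ℂ}
    (h : ∀ u, arcEval u p = arcEval u q) : p = q := by
  refine MvPolynomial.funext fun x => ?_
  have hx : ∀ r, eval x r = arcEval (fun i η => PowerSeries.mk fun k => x ((i, η), k) / k !) r := by
    intro r
    rw [← MvPolynomial.aeval_eq_eval, arcEval]
    refine congrArg (fun y => aeval y r) (_root_.funext fun v => ?_)
    rw [PowerSeries.coeff_mk, mul_div_cancel₀]
    exact_mod_cast Nat.factorial_ne_zero _
  rw [hx, hx, h]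

theorem arcDer_X (m : ℕ) (ξ : Fin 3) (r : ℕ) (v : (Fin m × Fin 3) × ℕ) :
    arcDer m ξ r (X v) = (v.2.descFactorial r : ℂ) •
      ∑ θ : Fin 3, C (slBr ξ v.1.2 θ) * X ((v.1.1, θ), v.2 - r) :=
  mkDerivation_X _ _ _

theorem arcDer_arcD {m : ℕ} (ξ : Fin 3) (r : ℕ) (p : MvPolynomial ((Fin m × Fin 3) × ℕ) ℂ) :
    arcDer m ξ r (arcD m p) = arcD m (arcDer m ξ r p) + (r : ℂ) • arcDer m ξ (r - 1) p := by
  suffices h : ⁅arcDer m ξ r, arcD m⁆ = (r : ℂ) • arcDer m ξ (r - 1) by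
    have h' := congrArg (fun d => d p) h
    simp only [Derivation.commutator_apply, Derivation.smul_apply] at h'
    rw [← h']; ring
  have hX (w : (Fin m × Fin 3) × ℕ) : arcD m (X w) = X (w.1, w.2 + 1) := mkDerivation_X _ _ _
  refine derivation_ext fun ⟨v, k⟩ => ?_
  simp only [Derivation.commutator_apply, Derivation.smul_apply, arcDer_X, hX, Derivation.map_smul,
    map_sum, Derivation.leibniz, smul_eq_mul, derivation_C, mul_zero, add_zero]
  rcases r with - | r
  · simp
  have h1 : (k + 1).descFactorial (r + 1) = (k + 1) * k.descFactorial r :=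
    Nat.succ_descFactorial_succ _ _
  have h2 : k.descFactorial (r + 1) = (k - r) * k.descFactorial r := Nat.descFactorial_succ _ _
  rw [h1, h2, Nat.add_sub_cancel, Nat.add_sub_add_right]
  rcases lt_trichotomy k r with h | rfl | h
  · simp [Nat.descFactorial_eq_zero_iff_lt.2 h]
  · simp [smul_smul]
  · have e : k - (r + 1) + 1 = k - r := by omega
    rw [e, smul_smul, ← sub_smul, Nat.cast_mul, Nat.cast_mul, Nat.cast_sub h.le]
    congr 1
    push_cast
    ring

theorem arcDer_arcQ (m : ℕ) (ξ : Fin 3) (r : ℕ) (i j : Fin m) :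
    arcDer m ξ r (arcQ m i j) = 0 := by
  have h2 : arcDer m ξ r 2 = 0 := by
    simpa using (arcDer m ξ r).map_natCast 2
  rcases r with - | r
  · have hC : (C (2 : ℂ) : MvPolynomial ((Fin m × Fin 3) × ℕ) ℂ) = 2 := map_ofNat _ 2
    simp only [arcQ, map_add, Derivation.leibniz, h2, arcDer_X, Fin.sum_univ_three, smul_eq_mul]
    fin_cases ξ <;> simp [slBr, hC] <;> ring
  · simp [arcQ, Derivation.leibniz, h2, arcDer_X]

theorem arcDer_iterate_arcD_arcQ (m : ℕ) (ξ : Fin 3) (k : ℕ) (i j : Fin m) (r : ℕ) :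
    arcDer m ξ r ((arcD m)^[k] (arcQ m i j)) = 0 := by
  induction k generalizing r with
  | zero => exact arcDer_arcQ m ξ r i j
  | succ k ih => rw [Function.iterate_succ_apply', arcDer_arcD, ih, ih, map_zero, smul_zero, add_zero]

theorem arcDer_eq_zero_of_mem_adjoin {m : ℕ} {p : MvPolynomial ((Fin m × Fin 3) × ℕ) ℂ}
    (hp : p ∈ Algebra.adjoin ℂ {w | ∃ (k : ℕ) (i j : Fin m), w = (⇑(arcD m))^[k] (arcQ m i j)})
    (ξ : Fin 3) (r : ℕ) : arcDer m ξ r p = 0 := by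
  induction hp using Algebra.adjoin_induction with
  | mem x hx => obtain ⟨k, i, j, rfl⟩ := hx; exact arcDer_iterate_arcD_arcQ m ξ k i j r
  | algebraMap a => exact Derivation.map_algebraMap _ _
  | add x y _ _ hx hy => rw [map_add, hx, hy, add_zero]
  | mul x y _ _ hx hy => rw [Derivation.leibniz, hx, hy, smul_zero, smul_zero, add_zero]

/-- The action of the basis vector `ξ` of `sl₂` on a power series with values in the adjoint
representation. -/
noncomputable def arcLie (ξ : Fin 3) (w : Fin 3 → ℂ⟦X⟧) : Fin 3 → ℂ⟦X⟧ :=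
  fun η => ∑ θ : Fin 3, PowerSeries.C (slBr ξ η θ) * w θ

/-- The action of `exp (f ξ)`, for `ξ` acting with vanishing cube. -/
noncomputable def arcExp (ξ : Fin 3) (f : ℂ⟦X⟧) (w : Fin 3 → ℂ⟦X⟧) : Fin 3 → ℂ⟦X⟧ :=
  fun η => w η + f * arcLie ξ w η + PowerSeries.C (1 / 2) * f ^ 2 * arcLie ξ (arcLie ξ w) η

theorem arcLie_mul_left (ξ : Fin 3) (g : ℂ⟦X⟧) (w : Fin 3 → ℂ⟦X⟧) (η : Fin 3) :
    arcLie ξ (fun θ => g * w θ) η = g * arcLie ξ w η := by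
  simp only [arcLie, Finset.mul_sum]
  exact Finset.sum_congr rfl fun θ _ => by ring

theorem arcLie_arcLie_arcLie {ξ : Fin 3} (hξ : ξ ≠ 0) (w : Fin 3 → ℂ⟦X⟧) :
    arcLie ξ (arcLie ξ (arcLie ξ w)) = 0 := by
  funext η
  fin_cases ξ
  · exact absurd rfl hξ
  all_goals
    fin_cases η <;> simp [arcLie, slBr, Fin.sum_univ_three]

/-- The derivation `∑ r, fᵣ ξ t^r` of the arc space ring, a finite sum on each generator. -/
noncomputable def arcDerSeries (m : ℕ) (ξ : Fin 3) (f : ℂ⟦X⟧) :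
    Derivation ℂ (MvPolynomial ((Fin m × Fin 3) × ℕ) ℂ) (MvPolynomial ((Fin m × Fin 3) × ℕ) ℂ) :=
  MvPolynomial.mkDerivation ℂ fun v =>
    ∑ r ∈ Finset.range (v.2 + 1), PowerSeries.coeff r f • arcDer m ξ r (X v)

theorem arcDerSeries_eq_zero {m : ℕ} {ξ : Fin 3} {p : MvPolynomial ((Fin m × Fin 3) × ℕ) ℂ}
    (hp : ∀ r, arcDer m ξ r p = 0) (f : ℂ⟦X⟧) : arcDerSeries m ξ f p = 0 := by
  set N := p.vars.sup (fun v => v.2) + 1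
  have hs (q) : (∑ r ∈ Finset.range N, PowerSeries.coeff r f • arcDer m ξ r) q =
      ∑ r ∈ Finset.range N, PowerSeries.coeff r f • arcDer m ξ r q := by
    have h := map_sum Derivation.coeFnAddMonoidHom
      (fun r => PowerSeries.coeff r f • arcDer m ξ r) (Finset.range N)
    exact (congrFun h q).trans (Finset.sum_apply _ _ _)
  have h : arcDerSeries m ξ f p =
      (∑ r ∈ Finset.range N, PowerSeries.coeff r f • arcDer m ξ r) p := by
    refine derivation_eq_of_forall_mem_vars fun v hv => ?_
    rw [arcDerSeries, mkDerivation_X, hs]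
    refine Finset.sum_subset (Finset.range_mono (Nat.succ_le_succ (Finset.le_sup hv))) ?_
    intro r _ hr
    rw [arcDer_X, Nat.descFactorial_eq_zero_iff_lt.2 (by simpa using hr)]
    simp
  rw [h, hs]
  exact Finset.sum_eq_zero fun r _ => by rw [hp, smul_zero]

theorem sum_descFactorial_mul_coeff (ξ η : Fin 3) (f : ℂ⟦X⟧) (w : Fin 3 → ℂ⟦X⟧) (k : ℕ) :
    ∑ r ∈ Finset.range (k + 1), PowerSeries.coeff r f * ((k.descFactorial r : ℂ) *
      ∑ θ : Fin 3, slBr ξ η θ * (((k - r)! : ℂ) * PowerSeries.coeff (k - r) (w θ))) =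
      k ! * PowerSeries.coeff k (f * arcLie ξ w η) := by
  rw [PowerSeries.coeff_mul, Finset.Nat.sum_antidiagonal_eq_sum_range_succ_mk, Finset.mul_sum]
  refine Finset.sum_congr rfl fun r hr => ?_
  have h : ((k - r)! : ℂ) * k.descFactorial r = k ! := by
    exact_mod_cast Nat.factorial_mul_descFactorial (Nat.lt_succ_iff.1 (Finset.mem_range.1 hr))
  rw [← h, arcLie, map_sum]
  simp only [PowerSeries.coeff_C_mul, Finset.mul_sum]
  exact Finset.sum_congr rfl fun θ _ => by ring

theorem arcEval_arcExp {m : ℕ} {ξ : Fin 3} (hξ : ξ ≠ 0)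
    {p : MvPolynomial ((Fin m × Fin 3) × ℕ) ℂ} (hp : ∀ r, arcDer m ξ r p = 0)
    (f : ℂ⟦X⟧) (u : Fin m → Fin 3 → ℂ⟦X⟧) :
    arcEval (fun i => arcExp ξ f (u i)) p = arcEval u p := by
  let b : Fin m → Fin 3 → ℂ⟦X⟧ := fun i η => f * arcLie ξ (u i) η
  let c : Fin m → Fin 3 → ℂ⟦X⟧ := fun i η =>
    PowerSeries.C (1 / 2) * f ^ 2 * arcLie ξ (arcLie ξ (u i)) η
  let Φ : MvPolynomial ((Fin m × Fin 3) × ℕ) ℂ →ₐ[ℂ] Polynomial ℂ := aeval fun v =>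
    Polynomial.C ((v.2 ! : ℂ) * PowerSeries.coeff v.2 (u v.1.1 v.1.2)) +
    Polynomial.C ((v.2 ! : ℂ) * PowerSeries.coeff v.2 (b v.1.1 v.1.2)) * Polynomial.X +
    Polynomial.C ((v.2 ! : ℂ) * PowerSeries.coeff v.2 (c v.1.1 v.1.2)) * Polynomial.X ^ 2
  have hb (i : Fin m) (η : Fin 3) : f * arcLie ξ (b i) η = 2 * c i η := by
    have h2 : (2 : ℂ⟦X⟧) * PowerSeries.C (1 / 2) = 1 := by
      rw [← map_ofNat (PowerSeries.C (R := ℂ)) 2, ← map_mul]; norm_num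
    rw [arcLie_mul_left]
    linear_combination (-f ^ 2 * arcLie ξ (arcLie ξ (u i)) η) * h2
  have hc (i : Fin m) (η : Fin 3) : f * arcLie ξ (c i) η = 0 := by
    rw [arcLie_mul_left, arcLie_arcLie_arcLie hξ]; simp
  have hΦX (v) : Polynomial.derivative (Φ (X v)) = Φ (arcDerSeries m ξ f (X v)) := by
    obtain ⟨⟨i, η⟩, k⟩ := v
    have ea := sum_descFactorial_mul_coeff ξ η f (u i) k
    have eb := sum_descFactorial_mul_coeff ξ η f (b i) k
    have ec := sum_descFactorial_mul_coeff ξ η f (c i) k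
    rw [hb] at eb
    rw [hc] at ec
    have hR : Φ (arcDerSeries m ξ f (X ((i, η), k))) =
        Polynomial.C ((k ! : ℂ) * PowerSeries.coeff k (b i η)) +
        Polynomial.C ((k ! : ℂ) * PowerSeries.coeff k (2 * c i η)) * Polynomial.X +
        Polynomial.C ((k ! : ℂ) * PowerSeries.coeff k 0) * Polynomial.X ^ 2 := by
      rw [← eb, ← ec, ← ea, arcDerSeries, mkDerivation_X]
      simp only [arcDer_X, map_sum, map_smul, map_mul, Finset.sum_mul, ← Finset.sum_add_distrib,
        Φ, aeval_X, aeval_C, Polynomial.smul_eq_C_mul, Finset.mul_sum]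
      refine Finset.sum_congr rfl fun r _ => Finset.sum_congr rfl fun θ _ => ?_
      simp only [Polynomial.algebraMap_eq]
      ring
    have h2 : PowerSeries.coeff k (2 * c i η) = 2 * PowerSeries.coeff k (c i η) := by
      rw [← map_ofNat (PowerSeries.C (R := ℂ)) 2, PowerSeries.coeff_C_mul]
    rw [hR, h2]
    simp only [Φ, aeval_X, Polynomial.derivative_add, Polynomial.derivative_C_mul,
      Polynomial.derivative_C, Polynomial.derivative_X, Polynomial.derivative_X_sq]
    simp only [map_mul, map_zero, map_ofNat]
    ring
  have hΦ (q) : Polynomial.derivative (Φ q) = Φ (arcDerSeries m ξ f q) := by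
    induction q using MvPolynomial.induction_on with
    | C a =>
      rw [MvPolynomial.derivation_C, ← MvPolynomial.algebraMap_eq, AlgHom.commutes, map_zero,
        Polynomial.algebraMap_eq, Polynomial.derivative_C]
    | add p q hp hq => simp only [map_add, hp, hq]
    | mul_X p v hp =>
      rw [Derivation.leibniz, map_mul, Polynomial.derivative_mul, map_add, smul_eq_mul,
        smul_eq_mul, map_mul, map_mul, hΦX, hp]
      ring
  have h0 := hΦ p
  rw [arcDerSeries_eq_zero hp, map_zero] at h0
  obtain ⟨a, ha⟩ := Polynomial.natDegree_eq_zero.1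
    (Polynomial.derivative_eq_zero.1 h0)
  have h1 (s : ℂ) : (Polynomial.aeval s).comp Φ = aeval fun v => ((v.2 ! : ℂ) *
      PowerSeries.coeff v.2 (u v.1.1 v.1.2 + PowerSeries.C s * b v.1.1 v.1.2 +
        PowerSeries.C (s ^ 2) * c v.1.1 v.1.2)) := by
    refine MvPolynomial.algHom_ext fun v => ?_
    simp only [Φ, AlgHom.comp_apply, aeval_X, map_add, map_mul, map_pow, Polynomial.aeval_C,
      Polynomial.aeval_X, Algebra.algebraMap_self, RingHom.id_apply, PowerSeries.coeff_C_mul]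
    rw [← map_pow, PowerSeries.coeff_C_mul]
    ring
  have h2 := DFunLike.congr_fun (h1 0) p
  have h3 := DFunLike.congr_fun (h1 1) p
  rw [AlgHom.comp_apply, ← ha, Polynomial.aeval_C] at h2 h3
  simp only [ne_eq, OfNat.ofNat_ne_zero, not_false_eq_true, zero_pow, one_pow, map_zero, map_one,
    zero_mul, one_mul, add_zero] at h2 h3
  exact h3.symm.trans h2

theorem arcExp_one (f h x y : ℂ⟦X⟧) :
    arcExp 1 f ![h, x, y] = ![h - 2 * f * x, x, y + f * h - f ^ 2 * x] := by
  have h2 : (2 : ℂ⟦X⟧) * PowerSeries.C (1 / 2) = 1 := by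
    rw [← map_ofNat (PowerSeries.C (R := ℂ)) 2, ← map_mul]; norm_num
  have hC : PowerSeries.C (2 : ℂ) = 2 := map_ofNat _ 2
  funext η
  fin_cases η
  · simp [arcExp, arcLie, slBr, Fin.sum_univ_three, hC]; ring
  · simp [arcExp, arcLie, slBr, Fin.sum_univ_three]
  · simp [arcExp, arcLie, slBr, Fin.sum_univ_three, hC] at h2 ⊢; linear_combination -f ^ 2 * x * h2

theorem arcExp_two (f h x y : ℂ⟦X⟧) :
    arcExp 2 f ![h, x, y] = ![h + 2 * f * y, x - f * h - f ^ 2 * y, y] := by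
  have h2 : (2 : ℂ⟦X⟧) * PowerSeries.C (1 / 2) = 1 := by
    rw [← map_ofNat (PowerSeries.C (R := ℂ)) 2, ← map_mul]; norm_num
  have hC : PowerSeries.C (2 : ℂ) = 2 := map_ofNat _ 2
  funext η
  fin_cases η
  · simp [arcExp, arcLie, slBr, Fin.sum_univ_three, hC]; ring
  · simp [arcExp, arcLie, slBr, Fin.sum_univ_three, hC] at h2 ⊢; linear_combination -f ^ 2 * y * h2
  · simp [arcExp, arcLie, slBr, Fin.sum_univ_three]

theorem arcEval_pair_exp_one {p : MvPolynomial ((Fin 2 × Fin 3) × ℕ) ℂ}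
    (hp : ∀ (ξ : Fin 3) (r : ℕ), arcDer 2 ξ r p = 0) (f h₁ x₁ y₁ h₂ x₂ y₂ : ℂ⟦X⟧) :
    arcEval ![![h₁, x₁, y₁], ![h₂, x₂, y₂]] p =
      arcEval ![![h₁ - 2 * f * x₁, x₁, y₁ + f * h₁ - f ^ 2 * x₁],
        ![h₂ - 2 * f * x₂, x₂, y₂ + f * h₂ - f ^ 2 * x₂]] p := by
  rw [← arcEval_arcExp (ξ := 1) (by decide) (hp 1) f]
  congr 2
  funext i
  fin_cases i <;> exact arcExp_one _ _ _ _

theorem arcEval_pair_exp_two {p : MvPolynomial ((Fin 2 × Fin 3) × ℕ) ℂ}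
    (hp : ∀ (ξ : Fin 3) (r : ℕ), arcDer 2 ξ r p = 0) (f h₁ x₁ y₁ h₂ x₂ y₂ : ℂ⟦X⟧) :
    arcEval ![![h₁, x₁, y₁], ![h₂, x₂, y₂]] p =
      arcEval ![![h₁ + 2 * f * y₁, x₁ - f * h₁ - f ^ 2 * y₁, y₁],
        ![h₂ + 2 * f * y₂, x₂ - f * h₂ - f ^ 2 * y₂, y₂]] p := by
  rw [← arcEval_arcExp (ξ := 2) (by decide) (hp 2) f]
  congr 2
  funext i
  fin_cases i <;> exact arcExp_two _ _ _ _

theorem arcEval_pair_weyl {p : MvPolynomial ((Fin 2 × Fin 3) × ℕ) ℂ}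
    (hp : ∀ (ξ : Fin 3) (r : ℕ), arcDer 2 ξ r p = 0) {w v : ℂ⟦X⟧} (hwv : w * v = 1)
    (h₁ x₁ y₁ h₂ x₂ y₂ : ℂ⟦X⟧) :
    arcEval ![![h₁, x₁, y₁], ![h₂, x₂, y₂]] p =
      arcEval ![![-h₁, -v ^ 2 * y₁, -w ^ 2 * x₁], ![-h₂, -v ^ 2 * y₂, -w ^ 2 * x₂]] p := by
  have hX (h x y : ℂ⟦X⟧) : x - -v * (h - 2 * w * x) - (-v) ^ 2 * (y + w * h - w ^ 2 * x) =
      -v ^ 2 * y := by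
    linear_combination (x * (w * v - 1) - v * h) * hwv
  have hH (h x y : ℂ⟦X⟧) : h - 2 * w * x + 2 * -v * (y + w * h - w ^ 2 * x) = -h - 2 * v * y := by
    linear_combination (2 * w * x - 2 * h) * hwv
  have hH' (h y : ℂ⟦X⟧) : -h - 2 * v * y - 2 * w * (-v ^ 2 * y) = -h := by
    linear_combination 2 * v * y * hwv
  have hY (h x y : ℂ⟦X⟧) : y + w * h - w ^ 2 * x + w * (-h - 2 * v * y) - w ^ 2 * (-v ^ 2 * y) =
      -w ^ 2 * x := by
    linear_combination y * (w * v - 1) * hwv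
  rw [arcEval_pair_exp_one hp w, arcEval_pair_exp_two hp (-v), arcEval_pair_exp_one hp w]
  simp only [hX, hH, hH', hY]

/-- A generic pair of arcs can be moved by `SL₂(ℂ⟦t⟧)` to the slice `(α, 0, 0), (β, 1, c)`. -/
theorem exists_arcEval_eq_slice {p : MvPolynomial ((Fin 2 × Fin 3) × ℕ) ℂ}
    (hp : ∀ (ξ : Fin 3) (r : ℕ), arcDer 2 ξ r p = 0) {h₁ x₁ y₁ h₂ x₂ y₂ α a b d : ℂ⟦X⟧}
    (hα : α ^ 2 = arcForm ![h₁, x₁, y₁] ![h₁, x₁, y₁])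
    (ha : arcForm ![h₁, x₁, y₁] ![h₂, x₂, y₂] = a) (hb : arcForm ![h₂, x₂, y₂] ![h₂, x₂, y₂] = b)
    (hx : PowerSeries.constantCoeff x₁ ≠ 0) (hα0 : PowerSeries.constantCoeff α ≠ 0)
    (hd : α ^ 2 * b - a ^ 2 = d) (hd0 : PowerSeries.constantCoeff d ≠ 0) :
    ∃ β c : ℂ⟦X⟧, α * β = a ∧ β ^ 2 + 4 * c = b ∧
      arcEval ![![h₁, x₁, y₁], ![h₂, x₂, y₂]] p = arcEval ![![α, 0, 0], ![β, 1, c]] p := by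
  have h2 : (2 : ℂ⟦X⟧) * PowerSeries.C (1 / 2) = 1 := by
    rw [← map_ofNat (PowerSeries.C (R := ℂ)) 2, ← map_mul]; norm_num
  have hxi : x₁ * x₁⁻¹ = 1 := PowerSeries.mul_inv_cancel _ hx
  have hαi : α * α⁻¹ = 1 := PowerSeries.mul_inv_cancel _ hα0
  generalize x₁⁻¹ = xi at hxi
  generalize α⁻¹ = αi at hαi
  generalize PowerSeries.C (1 / 2 : ℂ) = s at h2
  simp [arcForm] at hα ha hb
  obtain ⟨f, hf⟩ : ∃ f, f * (2 * x₁) = h₁ + α :=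
    ⟨s * (h₁ + α) * xi, by linear_combination (h₁ + α) * (xi * x₁ * h2 + hxi)⟩
  have hy : y₁ + f * h₁ - f ^ 2 * x₁ = 0 := by
    have h4 : (4 : ℂ⟦X⟧) * x₁ * (s ^ 2 * xi) = 1 := by
      linear_combination (2 * s + 1) * h2 + 4 * s ^ 2 * hxi
    have : 4 * x₁ * (y₁ + f * h₁ - f ^ 2 * x₁) = 0 := by
      linear_combination -hα + (h₁ - α - f * (2 * x₁)) * hf
    linear_combination s ^ 2 * xi * this - (y₁ + f * h₁ - f ^ 2 * x₁) * h4
  have hh : h₁ - 2 * f * x₁ = -α := by linear_combination -hf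
  set h' := h₂ - 2 * f * x₂ with hh'
  set y' := y₂ + f * h₂ - f ^ 2 * x₂ with hy'
  have e1 := arcEval_pair_exp_one hp f h₁ x₁ y₁ h₂ x₂ y₂
  rw [hy, hh, ← hh', ← hy'] at e1
  obtain ⟨g, hg⟩ : ∃ g, g * α = -x₁ := ⟨-x₁ * αi, by linear_combination -x₁ * hαi⟩
  have e2 := arcEval_pair_exp_two hp g (-α) x₁ 0 h' x₂ y'
  rw [show x₁ - g * (-α) - g ^ 2 * 0 = 0 by linear_combination hg,
    show -α + 2 * g * 0 = -α by ring] at e2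
  set B := h' + 2 * g * y' with hB
  set Z := x₂ - g * h' - g ^ 2 * y' with hZ
  have hBa : α * (-B) = a := by
    rw [hB, ← ha, hy', hh']
    linear_combination -2 * (y₂ + f * h₂ - f ^ 2 * x₂) * hg + (h₂ - 2 * f * x₂) * hf - 2 * x₂ * hy
  have hBb : B ^ 2 + 4 * (Z * y') = b := by
    rw [hB, hZ, ← hb, hy', hh']; ring
  have hY : PowerSeries.constantCoeff y' ≠ 0 := by
    intro h0
    apply hd0
    have : d = 4 * α ^ 2 * Z * y' := by rw [← hd, ← hBa, ← hBb]; ring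
    rw [this, map_mul, h0, mul_zero]
  obtain ⟨w, hw⟩ := PowerSeries.exists_sq_eq_of_constantCoeff_ne_zero (f := -y') (by simpa using hY)
  have hw0 : PowerSeries.constantCoeff w ≠ 0 := by
    intro h0
    apply hY
    rw [← neg_neg y', ← hw, map_neg, map_pow, h0]; simp
  have hwi : w * w⁻¹ = 1 := PowerSeries.mul_inv_cancel _ hw0
  generalize w⁻¹ = wi at hwi
  refine ⟨-B, Z * y', hBa, by linear_combination hBb, ?_⟩
  have hx' : -wi ^ 2 * y' = 1 := by linear_combination (w * wi + 1) * hwi - wi ^ 2 * hw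
  have hy'' : -w ^ 2 * Z = Z * y' := by linear_combination -Z * hw
  rw [e1, e2, arcEval_pair_weyl hp hwi, hx', hy'']
  simp only [neg_neg, mul_zero]

/-- The three entries of the Gram matrix of a pair of arcs. -/
noncomputable def arcGram (u : Fin 2 → Fin 3 → ℂ⟦X⟧) : Fin 3 → ℂ⟦X⟧ :=
  ![arcForm (u 0) (u 0), arcForm (u 0) (u 1), arcForm (u 1) (u 1)]

/-- Evaluation of a polynomial in the coefficients of three power series. -/
noncomputable def gramEval (Q : Fin 3 → ℂ⟦X⟧) : MvPolynomial (Fin 3 × ℕ) ℂ →ₐ[ℂ] ℂ :=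
  aeval fun v => PowerSeries.coeff v.2 (Q v.1)

/-- Pullback of functions along the Gram map on arc spaces. -/
noncomputable def gramPullback :
    MvPolynomial (Fin 3 × ℕ) ℂ →ₐ[ℂ] MvPolynomial ((Fin 2 × Fin 3) × ℕ) ℂ :=
  aeval fun v => (v.2 ! : ℂ)⁻¹ • (arcD 2)^[v.2]
    (arcQ 2 ((![0, 0, 1] : Fin 3 → Fin 2) v.1) ((![0, 1, 1] : Fin 3 → Fin 2) v.1))

theorem arcEval_gramPullback (u : Fin 2 → Fin 3 → ℂ⟦X⟧) (F : MvPolynomial (Fin 3 × ℕ) ℂ) :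
    arcEval u (gramPullback F) = gramEval (arcGram u) F := by
  have h : (arcEval u).comp gramPullback = gramEval (arcGram u) := by
    refine MvPolynomial.algHom_ext fun ⟨j, k⟩ => ?_
    have hk : (k ! : ℂ) ≠ 0 := by exact_mod_cast Nat.factorial_ne_zero _
    simp only [gramPullback, gramEval, AlgHom.comp_apply, aeval_X, map_smul, smul_eq_mul,
      arcEval_iterate_arcD_arcQ]
    rw [inv_mul_cancel_left₀ hk]
    fin_cases j <;> rfl
  exact DFunLike.congr_fun h F

theorem gramPullback_mem_adjoin (F : MvPolynomial (Fin 3 × ℕ) ℂ) :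
    gramPullback F ∈
      Algebra.adjoin ℂ {w | ∃ (k : ℕ) (i j : Fin 2), w = (⇑(arcD 2))^[k] (arcQ 2 i j)} := by
  induction F using MvPolynomial.induction_on with
  | C a => rw [← MvPolynomial.algebraMap_eq, AlgHom.commutes]; exact Subalgebra.algebraMap_mem _ _
  | add p q hp hq => rw [map_add]; exact add_mem hp hq
  | mul_X p v hp =>
    rw [map_mul]
    refine mul_mem hp ?_
    rw [gramPullback, aeval_X]
    refine Subalgebra.smul_mem _ (Algebra.subset_adjoin ?_) _
    exact ⟨_, _, _, rfl⟩

theorem arcEval_arcQ {m : ℕ} (u : Fin m → Fin 3 → ℂ⟦X⟧) (i j : Fin m) :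
    arcEval u (arcQ m i j) = PowerSeries.constantCoeff (arcForm (u i) (u j)) := by
  simpa using arcEval_iterate_arcD_arcQ u 0 i j

theorem gramPullback_X_zero_zero : gramPullback (X (0, 0)) = arcQ 2 0 0 := by
  simp [gramPullback]

theorem arcQ_zero_zero_ne_zero : arcQ 2 0 0 ≠ 0 := by
  intro h
  have := arcEval_arcQ (m := 2) (fun _ => ![1, 0, 0]) 0 0
  simp [h, arcForm] at this

/-- A multiple of `q₁₁` which is a polynomial in the coefficients of the Gram matrix is
`q₁₁` times such a polynomial. -/
theorem mem_range_gramPullback_of_arcQ_mul {f : MvPolynomial ((Fin 2 × Fin 3) × ℕ) ℂ}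
    (hf : arcQ 2 0 0 * f ∈ gramPullback.range) : f ∈ gramPullback.range := by
  obtain ⟨F, hF⟩ := hf
  replace hF : gramPullback F = arcQ 2 0 0 * f := hF
  let F' : MvPolynomial (Fin 3 × ℕ) ℂ := aeval (fun v => if v = (0, 0) then 0 else X v) F
  have hdvd : X (0, 0) ∣ F - F' := by
    rw [← Ideal.mem_span_singleton, ← Ideal.Quotient.eq]
    let π := Ideal.Quotient.mkₐ ℂ (Ideal.span {(X (0, 0) : MvPolynomial (Fin 3 × ℕ) ℂ)})
    have h : π = π.comp (aeval fun v => if v = (0, 0) then 0 else X v) := by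
      refine MvPolynomial.algHom_ext fun v => ?_
      rw [AlgHom.comp_apply, aeval_X]
      split_ifs with hv
      · rw [hv, map_zero]
        exact Ideal.Quotient.eq_zero_iff_mem.2 (Ideal.mem_span_singleton_self _)
      · rfl
    exact DFunLike.congr_fun h F
  have hF' : X (2, 0) * F' = 0 := by
    refine MvPolynomial.funext fun x => ?_
    rw [map_mul, eval_X, map_zero, mul_eq_zero]
    by_cases h0 : x (2, 0) = 0
    · exact Or.inl h0
    right
    let Q : Fin 3 → ℂ⟦X⟧ := fun j =>
      PowerSeries.mk fun k => if (j, k) = ((0, 0) : Fin 3 × ℕ) then 0 else x (j, k)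
    have hQ0 : PowerSeries.constantCoeff (Q 0) = 0 := by
      rw [← PowerSeries.coeff_zero_eq_constantCoeff_apply, PowerSeries.coeff_mk]; simp
    have hQ2 : PowerSeries.constantCoeff (Q 2) ≠ 0 := by
      rw [← PowerSeries.coeff_zero_eq_constantCoeff_apply, PowerSeries.coeff_mk]; simpa using h0
    have hx : eval x F' = gramEval Q F := by
      change (aeval x : MvPolynomial (Fin 3 × ℕ) ℂ →ₐ[ℂ] ℂ) (aeval _ F) = _
      rw [← AlgHom.comp_apply]
      refine DFunLike.congr_fun (MvPolynomial.algHom_ext fun v => ?_) F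
      rw [AlgHom.comp_apply, aeval_X, gramEval, aeval_X, PowerSeries.coeff_mk]
      split_ifs <;> simp
    obtain ⟨h, hh⟩ := PowerSeries.exists_sq_eq_of_constantCoeff_ne_zero hQ2
    have h2 : (2 : ℂ⟦X⟧) * PowerSeries.C (1 / 2) = 1 := by
      rw [← map_ofNat (PowerSeries.C (R := ℂ)) 2, ← map_mul]; norm_num
    generalize PowerSeries.C (1 / 2 : ℂ) = s at h2
    let u : Fin 2 → Fin 3 → ℂ⟦X⟧ := ![![0, 1, s ^ 2 * Q 0], ![h, 0, s * Q 1]]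
    have hu : arcGram u = Q := by
      funext j
      fin_cases j
      · simp [arcGram, u, arcForm]
        linear_combination Q 0 * (2 * s + 1) * h2
      · simp [arcGram, u, arcForm]
        linear_combination Q 1 * h2
      · simp [arcGram, u, arcForm]
        linear_combination hh
    have hu0 : arcForm (u 0) (u 0) = Q 0 := congrFun hu 0
    rw [hx, ← hu, ← arcEval_gramPullback, hF, map_mul, arcEval_arcQ, hu0, hQ0, zero_mul]
  rw [(mul_eq_zero.1 hF').resolve_left (X_ne_zero _), sub_zero] at hdvd
  obtain ⟨G, rfl⟩ := hdvd
  rw [map_mul, gramPullback_X_zero_zero] at hF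
  exact ⟨G, mul_left_cancel₀ arcQ_zero_zero_ne_zero hF⟩

/-- The slice of pairs of arcs `(α, 0, 0), (β, 1, c)`, for `α` a unit. -/
noncomputable def arcSlice (α β c : ℂ⟦X⟧) : Fin 2 → Fin 3 → ℂ⟦X⟧ := ![![α, 0, 0], ![β, 1, c]]

/-- The parameters `(α, β, c)` of the slice. -/
abbrev SliceParam : Type := {ω : Fin 3 → ℂ⟦X⟧ // PowerSeries.constantCoeff (ω 0) ≠ 0}

/-- The Gram matrix of the point of the slice with given parameters. -/
noncomputable def sliceGram (ω : SliceParam) : Fin 3 → ℂ⟦X⟧ :=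
  ![ω.1 0 ^ 2, ω.1 0 * ω.1 1, ω.1 1 ^ 2 + 4 * ω.1 2]

/-- The functions on the slice that are polynomial in the coefficients of the Gram matrix, in
`α(0)` and in `1 / α(0)`. -/
noncomputable def sliceSubalgebra : Subalgebra ℂ (SliceParam → ℂ) where
  carrier := {f | ∃ (n : ℕ) (F₀ F₁ : MvPolynomial (Fin 3 × ℕ) ℂ), ∀ ω : SliceParam,
    f ω * (PowerSeries.constantCoeff (ω.1 0) ^ 2) ^ n = gramEval (sliceGram ω) F₀ +
      PowerSeries.constantCoeff (ω.1 0) * gramEval (sliceGram ω) F₁}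
  algebraMap_mem' a := ⟨0, C a, 0, fun ω => by
    simp [← MvPolynomial.algebraMap_eq]⟩
  add_mem' := by
    rintro f g ⟨n, F₀, F₁, hF⟩ ⟨k, G₀, G₁, hG⟩
    refine ⟨n + k, F₀ * X (0, 0) ^ k + G₀ * X (0, 0) ^ n,
      F₁ * X (0, 0) ^ k + G₁ * X (0, 0) ^ n, fun ω => ?_⟩
    have hX : gramEval (sliceGram ω) (X (0, 0)) = PowerSeries.constantCoeff (ω.1 0) ^ 2 := by
      simp [gramEval, sliceGram]
    simp only [map_add, map_mul, map_pow, hX, Pi.add_apply]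
    linear_combination (PowerSeries.constantCoeff (ω.1 0) ^ 2) ^ k * hF ω +
      (PowerSeries.constantCoeff (ω.1 0) ^ 2) ^ n * hG ω
  mul_mem' := by
    rintro f g ⟨n, F₀, F₁, hF⟩ ⟨k, G₀, G₁, hG⟩
    refine ⟨n + k, F₀ * G₀ + X (0, 0) * (F₁ * G₁), F₀ * G₁ + F₁ * G₀, fun ω => ?_⟩
    have hX : gramEval (sliceGram ω) (X (0, 0)) = PowerSeries.constantCoeff (ω.1 0) ^ 2 := by
      simp [gramEval, sliceGram]
    simp only [map_add, map_mul, hX, Pi.mul_apply]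
    rw [pow_add, mul_mul_mul_comm, hF, hG]
    ring

theorem coeff_sliceGram_mem (j : Fin 3) (k : ℕ) :
    (fun ω => PowerSeries.coeff k (sliceGram ω j)) ∈ sliceSubalgebra :=
  ⟨0, X (j, k), 0, fun ω => by simp [gramEval]⟩

theorem inv_constantCoeff_mem :
    (fun ω : SliceParam => (PowerSeries.constantCoeff (ω.1 0))⁻¹) ∈ sliceSubalgebra :=
  ⟨1, 0, 1, fun ω => by have := ω.2; simp; field_simp⟩

theorem coeff_alpha_mem (k : ℕ) :
    (fun ω : SliceParam => PowerSeries.coeff k (ω.1 0)) ∈ sliceSubalgebra := by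
  induction k using Nat.strong_induction_on with
  | _ k ih =>
  rcases k with - | k
  · exact ⟨0, 0, 1, fun ω => by simp⟩
  have h : (fun ω : SliceParam => PowerSeries.coeff (k + 1) (ω.1 0)) =
      (1 / 2 : ℂ) • ((fun ω => (PowerSeries.constantCoeff (ω.1 0))⁻¹) *
        ((fun ω => PowerSeries.coeff (k + 1) (sliceGram ω 0)) - ∑ i ∈ Finset.range k,
          (fun ω => PowerSeries.coeff (i + 1) (ω.1 0)) *
            fun ω => PowerSeries.coeff (k - i) (ω.1 0))) := by
    funext ω
    have h0 := ω.2
    simp only [Pi.smul_apply, Pi.mul_apply, Pi.sub_apply, Finset.sum_apply, sliceGram,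
      Matrix.cons_val_zero, sq]
    rw [PowerSeries.coeff_mul, Finset.Nat.sum_antidiagonal_eq_sum_range_succ_mk,
      Finset.sum_range_succ, Finset.sum_range_succ']
    simp only [Nat.add_sub_add_right, Nat.sub_zero, Nat.sub_self,
      PowerSeries.coeff_zero_eq_constantCoeff_apply, smul_eq_mul]
    field_simp
    ring
  rw [h]
  refine Subalgebra.smul_mem _ (mul_mem inv_constantCoeff_mem
    (sub_mem (coeff_sliceGram_mem 0 _) (sum_mem fun i hi => mul_mem (ih _ ?_) (ih _ ?_)))) _
  · have := Finset.mem_range.1 hi; omega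
  · omega

theorem coeff_beta_mem (k : ℕ) :
    (fun ω : SliceParam => PowerSeries.coeff k (ω.1 1)) ∈ sliceSubalgebra := by
  induction k using Nat.strong_induction_on with
  | _ k ih =>
  have h : (fun ω : SliceParam => PowerSeries.coeff k (ω.1 1)) =
      (fun ω => (PowerSeries.constantCoeff (ω.1 0))⁻¹) *
        ((fun ω => PowerSeries.coeff k (sliceGram ω 1)) - ∑ i ∈ Finset.range k,
          (fun ω => PowerSeries.coeff (i + 1) (ω.1 0)) *
            fun ω => PowerSeries.coeff (k - (i + 1)) (ω.1 1)) := by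
    funext ω
    have h0 := ω.2
    simp only [Pi.mul_apply, Pi.sub_apply, Finset.sum_apply, sliceGram,
      Matrix.cons_val_one, Matrix.cons_val_zero]
    rw [PowerSeries.coeff_mul, Finset.Nat.sum_antidiagonal_eq_sum_range_succ_mk,
      Finset.sum_range_succ']
    simp only [Nat.sub_zero, PowerSeries.coeff_zero_eq_constantCoeff_apply]
    field_simp
    ring
  rw [h]
  refine mul_mem inv_constantCoeff_mem
    (sub_mem (coeff_sliceGram_mem 1 _) (sum_mem fun i hi => mul_mem (coeff_alpha_mem _) (ih _ ?_)))
  have := Finset.mem_range.1 hi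
  omega

theorem coeff_gamma_mem (k : ℕ) :
    (fun ω : SliceParam => PowerSeries.coeff k (ω.1 2)) ∈ sliceSubalgebra := by
  have h : (fun ω : SliceParam => PowerSeries.coeff k (ω.1 2)) =
      (1 / 4 : ℂ) • ((fun ω => PowerSeries.coeff k (sliceGram ω 2)) -
        ∑ i ∈ Finset.HasAntidiagonal.antidiagonal k,
          (fun ω => PowerSeries.coeff i.1 (ω.1 1)) * fun ω => PowerSeries.coeff i.2 (ω.1 1)) := by
    funext ω
    have h4 : PowerSeries.coeff k (4 * ω.1 2) = 4 * PowerSeries.coeff k (ω.1 2) := by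
      rw [← map_ofNat (PowerSeries.C (R := ℂ)) 4, PowerSeries.coeff_C_mul]
    simp only [sliceGram, Matrix.cons_val, map_add, h4, sq, Pi.smul_apply, Pi.sub_apply,
      Finset.sum_apply, Pi.mul_apply, smul_eq_mul]
    rw [PowerSeries.coeff_mul]
    ring
  rw [h]
  exact Subalgebra.smul_mem _ (sub_mem (coeff_sliceGram_mem 2 _)
    (sum_mem fun i _ => mul_mem (coeff_beta_mem _) (coeff_beta_mem _))) _

theorem arcEval_arcSlice_mem (p : MvPolynomial ((Fin 2 × Fin 3) × ℕ) ℂ) :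
    (fun ω : SliceParam => arcEval (arcSlice (ω.1 0) (ω.1 1) (ω.1 2)) p) ∈ sliceSubalgebra := by
  induction p using MvPolynomial.induction_on with
  | C a =>
    simp only [← MvPolynomial.algebraMap_eq, AlgHom.commutes]
    exact sliceSubalgebra.algebraMap_mem a
  | add p q hp hq => simp only [map_add]; exact add_mem hp hq
  | mul_X p v hp =>
    simp only [map_mul]
    refine mul_mem hp ?_
    obtain ⟨⟨i, η⟩, k⟩ := v
    simp only [arcEval, aeval_X]
    refine mul_mem (sliceSubalgebra.algebraMap_mem (k ! : ℂ)) ?_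
    fin_cases i <;> fin_cases η
    · exact coeff_alpha_mem k
    · exact sliceSubalgebra.algebraMap_mem (PowerSeries.coeff k 0)
    · exact sliceSubalgebra.algebraMap_mem (PowerSeries.coeff k 0)
    · exact coeff_beta_mem k
    · exact sliceSubalgebra.algebraMap_mem (PowerSeries.coeff k 1)
    · exact coeff_gamma_mem k

theorem exists_arcQ_pow_mul_mem_range {p : MvPolynomial ((Fin 2 × Fin 3) × ℕ) ℂ}
    (hp : ∀ (ξ : Fin 3) (r : ℕ), arcDer 2 ξ r p = 0) :
    ∃ n : ℕ, arcQ 2 0 0 ^ n * p ∈ gramPullback.range := by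
  obtain ⟨n, F₀, F₁, hF⟩ := arcEval_arcSlice_mem p
  refine ⟨n, F₀, ?_⟩
  let d : MvPolynomial ((Fin 2 × Fin 3) × ℕ) ℂ :=
    X ((0, 1), 0) * arcQ 2 0 0 * (arcQ 2 0 0 * arcQ 2 1 1 - arcQ 2 0 1 ^ 2)
  have hd : d ≠ 0 := by
    intro h
    have h0 : arcEval ![![1, 1, 0], ![1, 1, 1]] d = 0 := by rw [h, map_zero]
    simp only [d, map_mul, map_sub, map_pow, arcEval_arcQ] at h0
    simp [arcEval, arcForm, map_ofNat (PowerSeries.constantCoeff (R := ℂ)) 2] at h0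
    norm_num at h0
  refine mul_left_cancel₀ hd (eq_of_forall_arcEval_eq fun u => ?_)
  rw [map_mul (arcEval u) d, map_mul (arcEval u) d]
  by_cases h0 : arcEval u d = 0
  · rw [h0, zero_mul, zero_mul]
  congr 1
  simp only [d, map_mul, mul_ne_zero_iff, map_sub, map_pow, arcEval_arcQ] at h0
  obtain ⟨⟨hx, hq⟩, hΔ⟩ := h0
  replace hx : PowerSeries.constantCoeff (u 0 1) ≠ 0 := by simpa [arcEval] using hx
  have hu (i : Fin 2) : u i = ![u i 0, u i 1, u i 2] := by
    funext η; fin_cases η <;> rfl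
  have hu' : u = ![![u 0 0, u 0 1, u 0 2], ![u 1 0, u 1 1, u 1 2]] := by
    funext i; fin_cases i <;> exact hu _
  have key (α : ℂ⟦X⟧) (hα : α ^ 2 = arcForm (u 0) (u 0)) :
      arcEval u p * PowerSeries.constantCoeff (arcForm (u 0) (u 0)) ^ n =
        gramEval (arcGram u) F₀ +
          PowerSeries.constantCoeff α * gramEval (arcGram u) F₁ := by
    have hα0 : PowerSeries.constantCoeff α ≠ 0 := by
      intro h
      rw [← hα, map_pow, h] at hq
      simp at hq
    obtain ⟨β, c, hβ, hc, he⟩ := exists_arcEval_eq_slice hp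
      (h₂ := u 1 0) (x₂ := u 1 1) (y₂ := u 1 2) (a := arcForm (u 0) (u 1))
      (b := arcForm (u 1) (u 1)) (by rw [hα, ← hu 0]) (by rw [← hu 0, ← hu 1]) (by rw [← hu 1])
      hx hα0 rfl (by rw [hα, map_sub, map_mul, map_pow]; exact hΔ)
    rw [← hu'] at he
    have h := hF ⟨![α, β, c], hα0⟩
    have hg : sliceGram ⟨![α, β, c], hα0⟩ = arcGram u := by
      simp only [sliceGram, arcGram, ← hα, ← hβ, ← hc]; rfl
    rw [hg] at h
    rw [he, ← hα, map_pow]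
    exact h
  obtain ⟨α, hα⟩ := PowerSeries.exists_sq_eq_of_constantCoeff_ne_zero hq
  have h1 := key α hα
  have h2 := key (-α) (by rw [neg_sq, hα])
  rw [map_neg] at h2
  change arcEval u (gramPullback F₀) = _
  rw [arcEval_gramPullback, map_mul, map_pow, arcEval_arcQ]
  linear_combination -(1 / 2 : ℂ) * h1 - (1 / 2 : ℂ) * h2

theorem mem_range_gramPullback_of_arcQ_pow_mul {f : MvPolynomial ((Fin 2 × Fin 3) × ℕ) ℂ} (n : ℕ)
    (hf : arcQ 2 0 0 ^ n * f ∈ gramPullback.range) : f ∈ gramPullback.range := by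
  induction n with
  | zero => simpa using hf
  | succ n ih => exact ih (mem_range_gramPullback_of_arcQ_mul (by rwa [← mul_assoc, ← pow_succ']))

/-- Theorem 6.3, first part: for `g = sl₂` acting diagonally on `W = V ⊕ V` (`V` the
adjoint representation), the invariant ring `O(J_∞(W))^{g[t]}` is generated as a
`ℂ`-algebra by the elements `D^k(q_{ij})`, `k ≥ 0`. -/
theorem stmt_9 :
    ∀ p : MvPolynomial ((Fin 2 × Fin 3) × ℕ) ℂ,
      (∀ (ξ : Fin 3) (r : ℕ), arcDer 2 ξ r p = 0) ↔
        p ∈ Algebra.adjoin ℂ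
          {w | ∃ (k : ℕ) (i j : Fin 2), w = (⇑(arcD 2))^[k] (arcQ 2 i j)} := by
  refine fun p => ⟨fun hp => ?_, fun hp ξ r => arcDer_eq_zero_of_mem_adjoin hp ξ r⟩
  obtain ⟨n, hn⟩ := exists_arcQ_pow_mul_mem_range hp
  obtain ⟨F, rfl⟩ := mem_range_gramPullback_of_arcQ_pow_mul n hn
  exact gramPullback_mem_adjoin F
end
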